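/- arXiv:1904.05307 — 3 statements merged into one kernel-verified Lean document; each statement's English description precedes it below -/
import Mathlib

section
/- Let ξ be a binomial random variable with parameters N and p, where 0 < p < 1 is fixed. Then for any fixed real h, as N → ∞, P[ξ ≤ Np + h·√(Np(1-p))] tends to Φ(h) = ∫_{-∞}^{h} (1/√(2π)) e^{-t²/2} dt. -/
open Finset Filter

noncomputable def binomPr (N : ℕ) (p : ℝ) (k : ℕ) : ℝ :=
  (N.choose k : ℝ) * p ^ k * (1 - p) ^ (N - k)

/-- `P[ξ ≤ x]` for `ξ ~ Bin(N, p)`. -/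
noncomputable def binomCdf (N : ℕ) (p : ℝ) (x : ℝ) : ℝ :=
  ∑ k ∈ Finset.range (N + 1), if (k : ℝ) ≤ x then binomPr N p k else 0

/-- Standard normal CDF. -/
noncomputable def Phi (x : ℝ) : ℝ :=
  ∫ t in Set.Iic x, (Real.sqrt (2 * Real.pi))⁻¹ * Real.exp (-t ^ 2 / 2)


open MeasureTheory ProbabilityTheory

lemma dML_integral_binomial (n : ℕ) (p : unitInterval) (f : ℕ → ℂ) :
    ∫ k, f k ∂(binomial n p) =
      ∑ k ∈ Finset.range (n + 1), ((binomPr n p k : ℝ) : ℂ) * f k := by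
  rw [binomial_eq_sum_dirac, integral_finsetSum_measure]
  · have : Finset.Iic n = Finset.range (n + 1) := by ext; simp
    rw [this]
    refine Finset.sum_congr rfl fun k _ => ?_
    rw [integral_smul_measure, integral_dirac, ENNReal.toReal_ofReal binomial_nonneg]
    simp [binomPr]
  · intro k _
    exact (integrable_dirac (by simp)).smul_measure (by simp)

lemma dML_charFun (n : ℕ) (p : unitInterval) (s t : ℝ) :
    charFun ((binomial n p).map (fun k : ℕ => (√n)⁻¹ * (((k : ℝ) - n * p) / s))) t =
    (charFun ((bernoulliMeasure ((1 - p) / s) (-p / s) p).map id) ((√n)⁻¹ * t)) ^ n := by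
  rw [charFun_apply_real, integral_map (by fun_prop) (by fun_prop), dML_integral_binomial]
  rw [Measure.map_id, charFun_apply_real, integral_bernoulliMeasure, add_pow]
  refine Finset.sum_congr rfl fun k hk => ?_
  have hk : k ≤ n := by simp at hk; omega
  simp only [Complex.real_smul, mul_pow, ← Complex.exp_nat_mul, binomPr]
  push_cast
  rw [Nat.cast_sub hk]
  have : ∀ a b c d e x y z : ℂ, z = x + y → c * a * b * Complex.exp z
      = a * Complex.exp x * (b * Complex.exp y) * c := by
    intro a b c d e x y z hz
    rw [hz, Complex.exp_add]; ring
  apply this _ _ _ 0 0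
  ring

lemma dML_cdf (n : ℕ) (p : unitInterval) (x : ℝ) :
    (binomial n p).real {k : ℕ | (k : ℝ) ≤ x} = binomCdf n p x := by
  have h := integral_binomial (n := n) (p := p)
    (Set.indicator {k : ℕ | (k : ℝ) ≤ x} (1 : ℕ → ℝ))
  rw [integral_indicator_one .of_discrete] at h
  rw [h, binomCdf]
  have : Finset.Iic n = Finset.range (n + 1) := by ext; simp
  rw [this]
  refine Finset.sum_congr rfl fun k _ => ?_
  by_cases hk : (k : ℝ) ≤ x <;> simp [hk, binomPr]

lemma dML_Phi (h : ℝ) : (gaussianReal 0 1).real (Set.Iic h) = Phi h := by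
  rw [measureReal_def, gaussianReal_apply_eq_integral _ (by simp), ENNReal.toReal_ofReal]
  · simp [Phi, gaussianPDFReal]
  · exact integral_nonneg fun _ => gaussianPDFReal_nonneg _ _ _

theorem deMoivreLaplace_cdf (p : ℝ) (hp0 : 0 < p) (hp1 : p < 1) (h : ℝ) :
    Tendsto (fun N : ℕ =>
        binomCdf N p ((N : ℝ) * p + h * Real.sqrt ((N : ℝ) * p * (1 - p))))
      atTop (nhds (Phi h)) := by
  let P : unitInterval := ⟨p, hp0.le, hp1.le⟩
  have hpq : 0 < p * (1 - p) := mul_pos hp0 (by linarith)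
  set s := √(p * (1 - p)) with hs
  have hs0 : 0 < s := Real.sqrt_pos.2 hpq
  have hss : s ^ 2 = p * (1 - p) := Real.sq_sqrt hpq.le
  let F : ℕ → ℕ → ℝ := fun n k => (√n)⁻¹ * (((k : ℝ) - n * p) / s)
  have hF : ∀ n, AEMeasurable (F n) (binomial n P) := fun n => by fun_prop
  let μ : ℕ → ProbabilityMeasure ℝ := fun n =>
    ⟨(binomial n P).map (F n), Measure.isProbabilityMeasure_map (hF n)⟩
  let ν : ProbabilityMeasure ℝ := ⟨gaussianReal 0 1, inferInstance⟩
  have hlim : Tendsto μ atTop (nhds ν) := by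
    refine ProbabilityMeasure.tendsto_iff_tendsto_charFun.2 fun t => ?_
    have key := tendsto_charFun_inv_sqrt_mul_pow
      (P := bernoulliMeasure ((1 - p) / s) (-p / s) P) (X := id) (by fun_prop)
      (by rw [integral_bernoulliMeasure]; simp [P]; ring)
      (by
        rw [integral_bernoulliMeasure]; simp [P]; field_simp; rw [hss]; ring) t
    have e : ∀ n, charFun ((μ n : ProbabilityMeasure ℝ) : Measure ℝ) t = _ :=
      fun n => dML_charFun n P s t
    simp only [e]
    have e2 : charFun (ν : Measure ℝ) t = Complex.exp (- t ^ 2 / 2) := by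
      simp [ν, charFun_gaussianReal, neg_div]
    rw [e2]
    exact key
  have h2 := ProbabilityMeasure.tendsto_measure_of_null_frontier_of_tendsto' hlim
    (E := Set.Iic h) (by
      have : NullSingletonClass (gaussianReal 0 1) := nullSingletonClass_gaussianReal (by simp)
      simp [ν])
  have h3 := (ENNReal.tendsto_toReal (measure_ne_top _ _)).comp h2
  rw [← dML_Phi]
  refine h3.congr' ?_
  filter_upwards [eventually_gt_atTop 0] with n hn
  have hn' : 0 < √(n : ℝ) := Real.sqrt_pos.2 (by exact_mod_cast hn)
  have e3 : binomCdf n p (n * p + h * √(n * p * (1 - p))) =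
      (binomial n P).real {k : ℕ | (k : ℝ) ≤ n * p + h * √(n * p * (1 - p))} :=
    (dML_cdf n P _).symm
  rw [e3]
  simp only [Function.comp, μ, ProbabilityMeasure.coe_mk]
  rw [Measure.map_apply (by fun_prop) measurableSet_Iic, measureReal_def]
  congr 2
  ext k
  simp only [Set.mem_preimage, Set.mem_Iic, Set.mem_ofPred_eq, F]
  rw [mul_assoc, Real.sqrt_mul (by positivity), ← hs, inv_mul_le_iff₀ hn', div_le_iff₀ hs0]
  constructor <;> intro <;> linarith
end

section
/- Let 0 < p < 1 be a fixed constant. Asymptotically almost surely, the maximum degree of the binomial random graph G(n,p) is at most pn + √(2p(1−p)n·ln n); that is, the probability of this event tends to 1 as n → ∞. -/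
open Classical Finset Filter

/-- Weight of a graph `G` under the Erdős–Rényi measure `G(n,p)`. -/
noncomputable def grWeight (n : ℕ) (p : ℝ) (G : SimpleGraph (Fin n)) : ℝ :=
  p ^ G.edgeFinset.card * (1 - p) ^ (n.choose 2 - G.edgeFinset.card)

/-- Probability of an event under `G(n,p)`. -/
noncomputable def grPr (n : ℕ) (p : ℝ) (A : Set (SimpleGraph (Fin n))) : ℝ :=
  ∑ G : SimpleGraph (Fin n), if G ∈ A then grWeight n p G else 0


theorem aux_genfun (n : ℕ) (p : ℝ) (v : Fin n) :
    ∑ G : SimpleGraph (Fin n), Polynomial.C (grWeight n p G) * Polynomial.X ^ (G.degree v)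
      = (Polynomial.C p * Polynomial.X + Polynomial.C (1-p))^(n-1) := by
  set E : Finset (Sym2 (Fin n)) := (⊤ : SimpleGraph (Fin n)).edgeFinset with hE
  have hEc : E.card = n.choose 2 := by
    rw [hE]
    have := SimpleGraph.card_edgeFinset_top_eq_card_choose_two (V := Fin n)
    rw [Fintype.card_fin] at this
    rw [← this]
  have hstar : (E.filter (fun e => v ∈ e)).card = n - 1 := by
    have h1 := SimpleGraph.complete_graph_degree v
    rw [Fintype.card_fin] at h1
    rw [← h1, ← SimpleGraph.card_incidenceFinset_eq_degree,
      SimpleGraph.incidenceFinset_eq_filter]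
  have hprod := Finset.prod_add
    (fun e : Sym2 (Fin n) => Polynomial.C p * (if v ∈ e then Polynomial.X else 1))
    (fun _ => Polynomial.C (1-p)) E
  have hl : ∏ e ∈ E, (Polynomial.C p * (if v ∈ e then Polynomial.X else 1) + Polynomial.C (1-p))
      = (Polynomial.C p * Polynomial.X + Polynomial.C (1-p))^(n-1) := by
    rw [← hstar, ← Finset.prod_const, Finset.prod_filter]
    apply Finset.prod_congr rfl
    intro e _
    split_ifs
    · rfl
    · rw [mul_one, ← Polynomial.C_add]; simp
  rw [← hl, hprod]
  refine Finset.sum_bij' (fun G _ => G.edgeFinset)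
    (fun S _ => SimpleGraph.fromEdgeSet (S : Set (Sym2 (Fin n)))) ?_ ?_ ?_ ?_ ?_
  · intro G _
    rw [Finset.mem_powerset, hE]
    exact SimpleGraph.edgeFinset_mono le_top
  · intros; simp
  · intro G _; simp
  · intro S hS
    ext e
    have : e ∈ S → ¬ e.IsDiag := by
      intro he
      have := Finset.mem_powerset.mp hS he
      simpa [hE] using this
    simp
    exact this
  · intro G _
    have hsub : G.edgeFinset ⊆ E := SimpleGraph.edgeFinset_mono le_top
    rw [Finset.prod_mul_distrib, Finset.prod_const, Finset.prod_const, ← Finset.prod_filter,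
      Finset.prod_const, Finset.card_sdiff_of_subset hsub, hEc, grWeight,
      ← SimpleGraph.card_incidenceFinset_eq_degree, SimpleGraph.incidenceFinset_eq_filter]
    simp only [Polynomial.C_mul, Polynomial.C_pow]
    ring

theorem aux_coeff (n : ℕ) (p : ℝ) (v : Fin n) (j : ℕ) :
    ∑ G : SimpleGraph (Fin n), (if G.degree v = j then grWeight n p G else 0)
      = ((n-1).choose j : ℝ) * p^j * (1-p)^(n-1-j) := by
  have h := congrArg (fun P => Polynomial.coeff P j) (aux_genfun n p v)
  simp only [Polynomial.finsetSum_coeff, Polynomial.coeff_C_mul_X_pow] at h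
  simp only [eq_comm (b := j)]
  rw [h, add_pow, Polynomial.finsetSum_coeff]
  have : ∀ i ∈ Finset.range (n-1+1), ((Polynomial.C p * Polynomial.X)^i * Polynomial.C (1-p)^(n-1-i)
      * ((n-1).choose i : Polynomial ℝ)).coeff j = if i = j then ((n-1).choose j : ℝ) * p^j * (1-p)^(n-1-j) else 0 := by
    intro i _
    have e : (Polynomial.C p * Polynomial.X)^i * Polynomial.C (1-p)^(n-1-i)
      * ((n-1).choose i : Polynomial ℝ) = Polynomial.C (((n-1).choose i : ℝ) * p^i * (1-p)^(n-1-i)) * Polynomial.X^i := by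
      simp only [Polynomial.C_mul, Polynomial.C_pow, mul_pow, map_natCast]
      ring
    rw [e, Polynomial.coeff_C_mul_X_pow]
    by_cases hij : i = j
    · subst hij; simp
    · simp [hij, Ne.symm hij]
  rw [Finset.sum_congr rfl this, Finset.sum_ite_eq']
  split_ifs with hj
  · rfl
  · rw [Nat.choose_eq_zero_of_lt (by simp at hj; omega)]; simp

theorem aux_total (n : ℕ) (hn : 1 ≤ n) (p : ℝ) :
    ∑ G : SimpleGraph (Fin n), grWeight n p G = 1 := by
  have h := congrArg (fun P => Polynomial.eval 1 P) (aux_genfun n p ⟨0, hn⟩)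
  simpa [Polynomial.eval_finsetSum] using h

theorem aux_union (n : ℕ) (hn : 1 ≤ n) (p : ℝ) (hp0 : 0 < p) (hp1 : p < 1) (T : ℝ) (k : ℕ)
    (hk : ∀ j : ℕ, T < j → k ≤ j) :
    |grPr n p {G | ∀ v : Fin n, (G.degree v : ℝ) ≤ T} - 1| ≤
      n * ∑ j ∈ Finset.Ico k (n-1+1), ((n-1).choose j : ℝ) * p^j * (1-p)^(n-1-j) := by
  have hq : 0 < 1 - p := by linarith
  have hw : ∀ G : SimpleGraph (Fin n), 0 ≤ grWeight n p G := by
    intro G; unfold grWeight; positivity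
  have e1 : grPr n p {G | ∀ v : Fin n, (G.degree v : ℝ) ≤ T} - 1 =
      -∑ G : SimpleGraph (Fin n), (if ∀ v : Fin n, (G.degree v : ℝ) ≤ T then 0 else grWeight n p G) := by
    rw [← aux_total n hn p, grPr, ← Finset.sum_sub_distrib, ← Finset.sum_neg_distrib]
    apply Finset.sum_congr rfl
    intro G _
    simp only [Set.mem_ofPred_eq]
    split_ifs <;> simp
  rw [e1, abs_neg, abs_of_nonneg (Finset.sum_nonneg (fun G _ => by split_ifs <;> simp [hw]))]
  calc _ ≤ ∑ G : SimpleGraph (Fin n), ∑ v : Fin n, ∑ j ∈ Finset.Ico k (n-1+1),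
        (if G.degree v = j then grWeight n p G else 0) := by
        apply Finset.sum_le_sum
        intro G _
        have hnn : ∀ v : Fin n, 0 ≤ ∑ j ∈ Finset.Ico k (n-1+1),
            (if G.degree v = j then grWeight n p G else 0) :=
          fun v => Finset.sum_nonneg (fun j _ => by split_ifs <;> simp [hw])
        split_ifs with h
        · exact Finset.sum_nonneg (fun v _ => hnn v)
        · push Not at h
          obtain ⟨v, hv⟩ := h
          refine le_trans ?_ (Finset.single_le_sum (fun v _ => hnn v) (Finset.mem_univ v))
          rw [Finset.sum_ite_eq, if_pos]
          have := G.degree_lt_card_verts v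
          rw [Fintype.card_fin] at this
          have := hk _ hv
          simp; omega
    _ = _ := by
        rw [Finset.sum_comm]
        have : ∀ v : Fin n, ∑ G : SimpleGraph (Fin n), ∑ j ∈ Finset.Ico k (n-1+1),
          (if G.degree v = j then grWeight n p G else 0) = ∑ j ∈ Finset.Ico k (n-1+1), ((n-1).choose j : ℝ) * p^j * (1-p)^(n-1-j) := by
          intro v
          rw [Finset.sum_comm]
          exact Finset.sum_congr rfl (fun j _ => aux_coeff n p v j)
        rw [Finset.sum_congr rfl (fun v _ => this v)]
        simp


theorem aux_ulogu (u : ℝ) (hu : 0 < u) :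
    (u - 1) + (u - 1)^2/2 - (u-1)^3/6 ≤ u * Real.log u := by
  -- first-derivative function
  let h : ℝ → ℝ := fun x => Real.log x - (x - 1) + (x-1)^2/2
  have hd : ∀ x : ℝ, 0 < x → HasDerivAt h (x⁻¹ - 1 + (x - 1)) x := by
    intro x hx
    have := ((Real.hasDerivAt_log hx.ne').sub ((hasDerivAt_id x).sub_const 1)).add
      ((((hasDerivAt_id x).sub_const 1).pow 2).div_const 2)
    refine HasDerivAt.congr_deriv (f' := _) this ?_
    simp
  have hmono : MonotoneOn h (Set.Ioi 0) := by
    apply monotoneOn_of_deriv_nonneg (convex_Ioi 0)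
    · exact fun x hx => (hd x hx).continuousAt.continuousWithinAt
    · intro x hx
      rw [interior_Ioi] at hx
      exact (hd x hx).differentiableAt.differentiableWithinAt
    · intro x hx
      rw [interior_Ioi] at hx
      have hx' : 0 < x := hx
      rw [(hd x hx).deriv]
      have : x⁻¹ - 1 + (x - 1) = (x-1)^2 / x := by field_simp; ring
      rw [this]; positivity
  let g : ℝ → ℝ := fun x => x * Real.log x - ((x - 1) + (x - 1)^2/2 - (x-1)^3/6)
  have gd : ∀ x : ℝ, 0 < x → HasDerivAt g (h x) x := by
    intro x hx
    have i1 := (hasDerivAt_id x).sub_const 1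
    have := (Real.hasDerivAt_mul_log hx.ne').sub ((i1.add ((i1.pow 2).div_const 2)).sub
      ((i1.pow 3).div_const 6))
    refine HasDerivAt.congr_deriv (f' := _) this ?_
    simp [h]; ring
  have h1 : h 1 = 0 := by simp [h]
  have g1 : g 1 = 0 := by simp [g]
  suffices 0 ≤ g u by simp only [g] at this; linarith
  rcases le_total 1 u with h' | h'
  · have : MonotoneOn g (Set.Ici 1) := by
      apply monotoneOn_of_deriv_nonneg (convex_Ici 1)
      · exact fun x hx => (gd x (lt_of_lt_of_le one_pos hx)).continuousAt.continuousWithinAt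
      · intro x hx
        rw [interior_Ici] at hx
        exact (gd x (lt_trans one_pos hx)).differentiableAt.differentiableWithinAt
      · intro x hx
        rw [interior_Ici] at hx
        have hx' : 1 < x := hx
        rw [(gd x (lt_trans one_pos hx)).deriv, ← h1]
        exact hmono (by simp) (by simp; linarith) hx'.le
    rw [← g1]; exact this (by simp) h' h'
  · have : AntitoneOn g (Set.Ioc 0 1) := by
      apply antitoneOn_of_deriv_nonpos (convex_Ioc 0 1)
      · exact fun x hx => (gd x hx.1).continuousAt.continuousWithinAt
      · intro x hx
        rw [interior_Ioc] at hx
        exact (gd x hx.1).differentiableAt.differentiableWithinAt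
      · intro x hx
        rw [interior_Ioc] at hx
        rw [(gd x hx.1).deriv, ← h1]
        exact hmono (by simpa using hx.1) (by simp) hx.2.le
    rw [← g1]; exact this ⟨hu, h'⟩ (by simp) h'

theorem aux_fact_lower (n : ℕ) : √(n:ℝ) * (n / Real.exp 1)^n ≤ (n.factorial : ℝ) := by
  refine le_trans ?_ (Stirling.le_factorial_stirling n)
  gcongr
  have := Real.pi_gt_three
  have : (0:ℝ) ≤ n := by positivity
  nlinarith

theorem aux_fact_upper (n : ℕ) (hn : 1 ≤ n) :
    (n.factorial : ℝ) ≤ Real.exp 1 * (√(n:ℝ) * (n / Real.exp 1)^n) := by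
  obtain ⟨m, rfl⟩ : ∃ m, n = m + 1 := ⟨n - 1, by omega⟩
  have h := Stirling.stirlingSeq'_antitone (Nat.zero_le m)
  simp only [Function.comp, Nat.succ_eq_add_one, zero_add, Stirling.stirlingSeq_one] at h
  rw [Stirling.stirlingSeq, div_le_iff₀ (by positivity)] at h
  refine h.trans (le_of_eq ?_)
  rw [Real.sqrt_mul (by norm_num)]
  have : √(2:ℝ) ≠ 0 := by positivity
  field_simp

theorem aux_pow_exp (N P k : ℝ) (kk : ℕ) (hk : (kk:ℝ) = k) (hk0 : 0 < k) (hN : 0 < N) (hP : 0 < P) :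
    (N * P / k)^kk ≤ Real.exp (-(N*P*((k/(N*P) - 1) + (k/(N*P) - 1)^2/2 - (k/(N*P)-1)^3/6))) := by
  have h := aux_ulogu (k/(N*P)) (by positivity)
  have e : (N * P / k)^kk = Real.exp (-(N*P*(k/(N*P) * Real.log (k/(N*P))))) := by
    rw [← Real.exp_log (show 0 < N * P / k by positivity), ← Real.exp_nat_mul, hk]
    congr 1
    rw [← inv_div, Real.log_inv]
    field_simp
  rw [e]
  gcongr

theorem aux_local (p : ℝ) (hp0 : 0 < p) (hp1 : p < 1) (k m : ℕ) (hk : 1 ≤ k) (hm : 1 ≤ m)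
    (N d : ℝ) (hN : N = k + m) (hd : d = k - N * p) (hd0 : 0 ≤ d) :
    ((k+m).choose k : ℝ) * p^k * (1-p)^m ≤
      Real.exp 1 * √(N / (k * m)) *
        Real.exp (-(d^2/(2*N*p*(1-p))) + d^3/(6*p^2*N^2)) := by
  have hk' : (0:ℝ) < k := by exact_mod_cast hk
  have hm' : (0:ℝ) < m := by exact_mod_cast hm
  have hN0 : 0 < N := by linarith
  have hq : 0 < 1 - p := by linarith
  have hch : ((k+m).choose k : ℝ) = ((k+m).factorial : ℝ) / (k.factorial * m.factorial) := by
    rw [eq_div_iff (by positivity)]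
    have := Nat.add_choose_mul_factorial_mul_factorial k m
    rw [Nat.choose_symm_add, ← this]; push_cast; ring
  have hU := aux_fact_upper (k+m) (by omega)
  have hLk := aux_fact_lower k
  have hLm := aux_fact_lower m
  have hcast : ((k+m : ℕ):ℝ) = N := by push_cast; exact hN.symm
  rw [hcast] at hU
  have s1 : ((k+m).choose k : ℝ) ≤ Real.exp 1 * (√N * (N / Real.exp 1)^(k+m)) /
      ((√(k:ℝ) * (k / Real.exp 1)^k) * (√(m:ℝ) * (m / Real.exp 1)^m)) := by
    rw [hch]; gcongr
  have s2 : Real.exp 1 * (√N * (N / Real.exp 1)^(k+m)) /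
      ((√(k:ℝ) * (k / Real.exp 1)^k) * (√(m:ℝ) * (m / Real.exp 1)^m)) * p^k * (1-p)^m
      = Real.exp 1 * √(N / (k * m)) * ((N * p / k)^k * (N * (1-p)/m)^m) := by
    rw [Real.sqrt_div hN0.le, Real.sqrt_mul hk'.le]
    simp only [div_pow, mul_pow, pow_add]
    have := Real.exp_pos 1
    field_simp
  calc ((k+m).choose k : ℝ) * p^k * (1-p)^m ≤ _ * p^k * (1-p)^m := by gcongr
    _ = _ := s2
    _ ≤ _ := by
      gcongr
      refine (mul_le_mul (aux_pow_exp N p k k rfl hk' hN0 hp0)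
        (aux_pow_exp N (1-p) m m rfl hm' hN0 hq) (by positivity) (by positivity)).trans ?_
      rw [← Real.exp_add]
      apply Real.exp_le_exp.mpr
      have e1 : (k:ℝ)/(N*p) - 1 = d/(N*p) := by rw [hd]; field_simp
      have e2 : (m:ℝ)/(N*(1-p)) - 1 = -(d/(N*(1-p))) := by
        rw [hd]; field_simp; rw [hN]; ring
      rw [e1, e2]
      have : -(N * p * (d / (N * p) + (d / (N * p)) ^ 2 / 2 - (d / (N * p)) ^ 3 / 6)) +
    -(N * (1 - p) * (-(d / (N * (1 - p))) + (-(d / (N * (1 - p)))) ^ 2 / 2 - (-(d / (N * (1 - p)))) ^ 3 / 6))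
        = -(d ^ 2 / (2 * N * p * (1 - p))) + d ^ 3 / (6 * p ^ 2 * N ^ 2) - d^3/(6*(1-p)^2*N^2) := by
        field_simp
        ring
      rw [this]
      have : 0 ≤ d^3/(6*(1-p)^2*N^2) := by positivity
      linarith

/-- de Moivre -/
theorem aux_tail (p : ℝ) (hp0 : 0 < p) (hp1 : p < 1) (N k : ℕ) :
    ((k:ℝ) - N * p) * ∑ j ∈ Finset.Ico k (N+1), (N.choose j : ℝ) * p^j * (1-p)^(N-j) ≤
      k * (1-p) * ((N.choose k : ℝ) * p^k * (1-p)^(N-k)) := by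
  have hq : 0 < 1 - p := by linarith
  rcases lt_or_ge N k with h | h
  · rw [Finset.Ico_eq_empty (by omega)]; simp; positivity
  set b : ℕ → ℝ := fun j => (N.choose j : ℝ) * p^j * (1-p)^(N-j) with hb
  set F : ℕ → ℝ := fun i : ℕ => -((i:ℝ) * (1-p) * b i) with hF
  have hstep : ∀ j ∈ Finset.Ico k (N+1), ((j:ℝ) - N * p) * b j =
      F (j+1) - F j := by
    intro j hj
    have hj2 : j ≤ N := by simp at hj; omega
    have key : ((j+1 : ℕ):ℝ) * (1-p) * b (j+1) = (N - j) * p * b j := by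
      rcases eq_or_lt_of_le hj2 with rfl | hlt
      · simp [hb]
      have h1 : (N.choose (j+1) : ℝ) * ((j+1 : ℕ):ℝ) = N.choose j * ((N:ℝ) - j) := by
        have := Nat.choose_succ_right_eq N j
        rw [← Nat.cast_sub hj2]; exact_mod_cast this
      have h2 : (1-p)^(N-j) = (1-p)^(N-(j+1)) * (1-p) := by
        rw [← pow_succ]; congr 1; omega
      simp only [hb]; rw [h2, pow_succ]
      linear_combination (1-p) * p^j*p * (1-p)^(N-(j+1)) * h1
    simp only [hF]
    rw [key]; ring
  have hsum := Finset.sum_congr rfl hstep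
  rw [Finset.sum_Ico_sub F (by omega)] at hsum
  have hz : b (N+1) = 0 := by simp [hb]
  simp only [hF, hz] at hsum
  calc _ = ∑ j ∈ Finset.Ico k (N+1), ((k:ℝ) - N * p) * b j := by rw [Finset.mul_sum]
    _ ≤ ∑ j ∈ Finset.Ico k (N+1), ((j:ℝ) - N * p) * b j := by
      apply Finset.sum_le_sum
      intro j hj
      have : (k:ℝ) ≤ j := by exact_mod_cast (Finset.mem_Ico.mp hj).1
      have : 0 ≤ b j := by simp only [hb]; positivity
      gcongr
    _ = _ := by rw [hsum]; ring

theorem aux_small (ε c : ℝ) (hε : 0 < ε) (hc : 0 < c) :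
    ∀ᶠ n : ℕ in atTop, √(c * n * Real.log n) + 2 ≤ ε * ((n:ℝ)^(1/3 : ℝ))^2 := by
  have h1 := (isLittleO_log_rpow_atTop (show (0:ℝ) < 1/3 by norm_num)).bound
    (show 0 < ε^2/(4*c) by positivity)
  have h2 := tendsto_natCast_atTop_atTop (R := ℝ) |>.eventually h1
  have h3 := ((tendsto_rpow_atTop (show (0:ℝ) < 1/3 by norm_num)).comp
    (tendsto_natCast_atTop_atTop (R := ℝ))).eventually_ge_atTop (max 1 (4/ε))
  filter_upwards [h2, h3, eventually_ge_atTop 1] with n h2 h3 hn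
  simp only [Function.comp] at h3
  have hn' : (1:ℝ) ≤ n := by exact_mod_cast hn
  set m := (n:ℝ)^(1/3 : ℝ) with hm
  have hm3 : m^3 = n := by
    rw [hm, ← Real.rpow_natCast, ← Real.rpow_mul (by positivity)]; norm_num
  have hm1 : 1 ≤ m := (le_max_left _ _).trans h3
  have hm4 : 4 ≤ ε * m := by
    have := (le_max_right _ _).trans h3
    rw [div_le_iff₀ hε] at this; linarith
  rw [Real.norm_of_nonneg (Real.log_nonneg hn'), Real.norm_of_nonneg (by positivity)] at h2
  have hs : √(c * n * Real.log n) ≤ ε * m^2 / 2 := by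
    rw [Real.sqrt_le_left (by positivity), ← hm3] 
    calc c * m^3 * Real.log (m^3) ≤ c * m^3 * (ε^2/(4*c) * m) := by
          rw [hm3] at *; gcongr
      _ = _ := by field_simp; ring
  have : ε * m ≤ ε * m^2 := by gcongr; nlinarith
  linarith

set_option maxHeartbeats 2000000 in
theorem aux_asymp (p : ℝ) (hp0 : 0 < p) (hp1 : p < 1) :
    ∀ᶠ n : ℕ in atTop, ∃ k : ℕ,
      (∀ j : ℕ, p * n + √(2 * p * (1-p) * n * Real.log n) < j → k ≤ j) ∧
      n * ∑ j ∈ Finset.Ico k (n-1+1), ((n-1).choose j : ℝ) * p^j * (1-p)^(n-1-j) ≤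
        (Real.exp 2 / (p * (1-p))) / √(Real.log n) := by
  have hq : 0 < 1 - p := by linarith
  set ε := min (p^2) ((1-p)/2) with hεd
  have hε : 0 < ε := by positivity
  filter_upwards [aux_small ε (2*p*(1-p)) hε (by positivity), eventually_ge_atTop 3] with n hs hn
  have hn' : (3:ℝ) ≤ n := by exact_mod_cast hn
  have hL : 0 < Real.log n := Real.log_pos (by linarith)
  set L := Real.log n with hLd
  set t := √(2 * p * (1-p) * n * L) with ht
  have ht0 : 0 < t := by positivity
  have ht2 : t^2 = 2 * p * (1-p) * n * L := Real.sq_sqrt (by positivity)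
  set m := (n:ℝ)^(1/3 : ℝ) with hm
  have hm3 : m^3 = n := by
    rw [hm, ← Real.rpow_natCast, ← Real.rpow_mul (by positivity)]; norm_num
  have hm1 : 1 ≤ m := Real.one_le_rpow (by linarith) (by norm_num)
  have hε1 : ε ≤ p^2 := min_le_left _ _
  have hε2 : ε ≤ (1-p)/2 := min_le_right _ _
  have hlin : t + 2 ≤ (1-p)/2 * n := by
    calc t + 2 ≤ ε * m^2 := hs
      _ ≤ (1-p)/2 * m^3 := by gcongr; norm_num
      _ = _ := by rw [hm3]
  have hcub : (t+2)^3 ≤ p^2 * n^2 := by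
    calc (t+2)^3 ≤ (ε * m^2)^3 := by gcongr
      _ = ε * ε^2 * n^2 := by rw [← hm3]; ring
      _ ≤ p^2 * 1 * n^2 := by
        gcongr
        have : ε ≤ 1 := by nlinarith
        nlinarith
      _ = _ := by ring
  refine ⟨⌊p * n + t⌋₊ + 1, fun j hj => ?_, ?_⟩
  · have := (Nat.floor_lt (by positivity)).mpr hj
    omega
  set k := ⌊p * n + t⌋₊ + 1 with hk
  have hk1 : p * n + t < k := by rw [hk]; push_cast; exact Nat.lt_floor_add_one _
  have hk2 : (k:ℝ) ≤ p * n + t + 1 := by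
    rw [hk]; push_cast
    have := Nat.floor_le (show 0 ≤ p * n + t by positivity)
    linarith
  have hkn : k + 1 < n := by
    have : (k:ℝ) + 1 < n := by nlinarith
    exact_mod_cast this
  obtain ⟨r, hr⟩ : ∃ r, n - 1 = k + r := ⟨n - 1 - k, by omega⟩
  have hr1 : 1 ≤ r := by omega
  have hnr : (n:ℝ) = k + r + 1 := by
    have : n = k + r + 1 := by omega
    exact_mod_cast this
  have htail := aux_tail p hp0 hp1 (n-1) k
  set S := ∑ j ∈ Finset.Ico k (n-1+1), ((n-1).choose j : ℝ) * p^j * (1-p)^(n-1-j) with hS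
  have hS0 : 0 ≤ S := Finset.sum_nonneg (fun j _ => by positivity)
  rw [hr, Nat.add_sub_cancel_left] at htail
  push_cast at htail
  set N : ℝ := k + r with hN
  have hNn : N = n - 1 := by rw [hnr]; ring
  set d : ℝ := k - N * p with hd
  have hd1 : t ≤ d := by rw [hd, hNn]; nlinarith
  have hd2 : d ≤ t + 2 := by rw [hd, hNn]; nlinarith
  have hloc := aux_local p hp0 hp1 k r (by omega) hr1 N d rfl rfl (by linarith)
  set b := ((k+r).choose k : ℝ) * p^k * (1-p)^r with hb
  have hN0 : 0 < N := by linarith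
  have hrl : (1-p)/2 * n ≤ r := by
    have : (r:ℝ) = n - 1 - k := by linarith
    rw [this]; nlinarith
  have hx : -(d^2/(2*N*p*(1-p))) + d^3/(6*p^2*N^2) ≤ -L + 1 := by
    have a1 : L ≤ d^2/(2*N*p*(1-p)) := by
      rw [le_div_iff₀ (by positivity)]
      calc L * (2*N*p*(1-p)) ≤ L * (2*n*p*(1-p)) := by gcongr; linarith
        _ = t^2 := by rw [ht2]; ring
        _ ≤ d^2 := by gcongr
    have a2 : d^3/(6*p^2*N^2) ≤ 1 := by
      rw [div_le_one (by positivity)]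
      calc d^3 ≤ (t+2)^3 := by
            have : 0 ≤ d := by linarith
            gcongr
        _ ≤ p^2 * n^2 := hcub
        _ ≤ p^2 * (6 * N^2) := by
          gcongr
          rw [hNn]; nlinarith
        _ = _ := by ring
    linarith
  have hsq : √(N / (k * r)) ≤ √(2/(p*(1-p)*n)) := by
    apply Real.sqrt_le_sqrt
    calc N / (k * r) ≤ n / ((p * n) * ((1-p)/2*n)) := by
          gcongr
          · linarith
          · linarith
      _ = _ := by field_simp
  have hb2 : b ≤ Real.exp 2 * √(2/(p*(1-p)*n)) / n := by
    refine hloc.trans ?_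
    calc _ ≤ Real.exp 1 * √(2/(p*(1-p)*n)) * Real.exp (-L+1) := by gcongr
      _ = _ := by
        rw [Real.exp_add, Real.exp_neg, hLd, Real.exp_log (by linarith),
          show (2:ℝ) = 1 + 1 by norm_num, Real.exp_add]
        field_simp
  have hSb : t * S ≤ n * b := by
    calc t * S ≤ d * S := by gcongr
      _ ≤ k * (1-p) * b := htail
      _ ≤ n * b := by
        have : 0 ≤ b := by positivity
        gcongr
        have : (0:ℝ) ≤ k := by positivity
        nlinarith
  have hst : √(2/(p*(1-p)*n)) * n = t * (1/(p*(1-p)) / √L) := by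
    have e : √(2/(p*(1-p)*n)) * √(2 * p * (1-p) * n * L) = 2 * √L := by
      rw [← Real.sqrt_mul (by positivity)]
      have : 2/(p*(1-p)*n) * (2 * p * (1-p) * n * L) = 2^2 * L := by field_simp
      rw [this, Real.sqrt_mul (by positivity), Real.sqrt_sq (by norm_num)]
    have hsL : √L ^ 2 = L := Real.sq_sqrt hL.le
    have hsL0 : 0 < √L := by positivity
    rw [← ht] at e
    apply mul_right_cancel₀ ht0.ne'
    calc _ = (√(2/(p*(1-p)*n)) * t) * n := by ring
      _ = 2 * √L * n := by rw [e]
      _ = t^2 * (1/(p*(1-p)) / √L) := by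
        rw [ht2]; field_simp; rw [hsL]
      _ = _ := by ring
  have : t * (n * S) ≤ t * ((Real.exp 2 / (p * (1-p))) / √L) := by
    calc t * (n * S) = n * (t * S) := by ring
      _ ≤ n * (n * b) := by gcongr
      _ ≤ n * (n * (Real.exp 2 * √(2/(p*(1-p)*n)) / n)) := by gcongr
      _ = Real.exp 2 * (√(2/(p*(1-p)*n)) * n) := by field_simp
      _ = _ := by rw [hst]; ring
  exact le_of_mul_le_mul_left this ht0

/-- A.a.s. the maximum degree of `G(n,p)` is at most `pn + √(2p(1-p)n ln n)`. -/
theorem aas_max_degree_upper (p : ℝ) (hp0 : 0 < p) (hp1 : p < 1) :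
    Tendsto (fun n : ℕ =>
        grPr n p {G | ∀ v : Fin n,
          (G.degree v : ℝ) ≤ p * n + Real.sqrt (2 * p * (1 - p) * n * Real.log n)})
      atTop (nhds 1) := by
  rw [tendsto_iff_dist_tendsto_zero]
  have hlim : Tendsto (fun n : ℕ => (Real.exp 2 / (p * (1-p))) / √(Real.log n)) atTop (nhds 0) :=
    tendsto_const_nhds.div_atTop (Real.tendsto_sqrt_atTop.comp
      (Real.tendsto_log_atTop.comp tendsto_natCast_atTop_atTop))
  refine squeeze_zero' (Eventually.of_forall fun n => dist_nonneg) ?_ hlim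
  filter_upwards [aux_asymp p hp0 hp1, eventually_ge_atTop 1] with n hn h1
  obtain ⟨k, hk, hb⟩ := hn
  rw [Real.dist_eq]
  exact (aux_union n h1 p hp0 hp1 _ k hk).trans hb
end

section
/- Let 0 < p < 1 be fixed. Let ζ be the number of vertices of G(n,p) with degree greater than np + √((1/2)·n·p(1−p)·ln n). Then E[ζ] ~ √(n^{3/2}/(π ln n)) as n → ∞, and for every fixed c > 0, a.a.s. ζ > c·√(n/(π ln n)). -/
open Classical Finset Filter

noncomputable def grEx (n : ℕ) (p : ℝ) (f : SimpleGraph (Fin n) → ℝ) : ℝ :=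
  ∑ G : SimpleGraph (Fin n), grWeight n p G * f G

/-- `ζ`: the number of vertices of degree greater than `np + √((1/2)np(1-p)ln n)`. -/
noncomputable def zeta (n : ℕ) (p : ℝ) (G : SimpleGraph (Fin n)) : ℕ :=
  (Finset.univ.filter (fun v : Fin n =>
    (n : ℝ) * p + Real.sqrt ((1 / 2) * n * p * (1 - p) * Real.log n)
      < (G.degree v : ℝ))).card


noncomputable def zEx {α : Type*} (p : ℝ) (E : Finset α) (f : Finset α → ℝ) : ℝ :=
  ∑ S ∈ E.powerset, p ^ S.card * (1 - p) ^ (E.card - S.card) * f S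

noncomputable def zb (p : ℝ) (N k : ℕ) : ℝ := (N.choose k : ℝ) * p ^ k * (1 - p) ^ (N - k)

noncomputable def zSum (p : ℝ) (N : ℕ) (g : ℕ → ℝ) : ℝ := ∑ k ∈ range (N + 1), zb p N k * g k

lemma zEx_empty {α : Type*} (p : ℝ) (f : Finset α → ℝ) : zEx p ∅ f = f ∅ := by
  simp [zEx]

lemma zEx_insert {α : Type*} [DecidableEq α] (p : ℝ) (e : α) (E : Finset α) (he : e ∉ E) (f : Finset α → ℝ) :
    zEx p (insert e E) f = p * zEx p E (fun S => f (insert e S)) + (1 - p) * zEx p E f := by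
  unfold zEx
  rw [Finset.sum_powerset_insert he, add_comm, Finset.mul_sum, Finset.mul_sum]
  congr 1
  · apply Finset.sum_congr rfl
    intro S hS
    have hS' := Finset.mem_powerset.1 hS
    have : e ∉ S := fun h => he (hS' h)
    rw [Finset.card_insert_of_notMem this, Finset.card_insert_of_notMem he]
    rw [Nat.add_sub_add_right]
    ring
  · apply Finset.sum_congr rfl
    intro S hS
    have hS' := Finset.card_le_card (Finset.mem_powerset.1 hS)
    rw [Finset.card_insert_of_notMem he, Nat.succ_sub hS', pow_succ]
    ring

lemma zEx_congr {α : Type*} (p : ℝ) (E : Finset α) {f g : Finset α → ℝ}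
    (h : ∀ S, S ⊆ E → f S = g S) : zEx p E f = zEx p E g := by
  unfold zEx
  apply Finset.sum_congr rfl
  intro S hS
  rw [h S (Finset.mem_powerset.1 hS)]

lemma zEx_union {α : Type*} [DecidableEq α] (p : ℝ) (A B : Finset α) (h : Disjoint A B) (f : Finset α → ℝ) :
    zEx p (A ∪ B) f = zEx p A (fun S => zEx p B (fun T => f (S ∪ T))) := by
  induction A using Finset.induction_on generalizing f with
  | empty => simp [zEx_empty]
  | insert a A ha ih =>
    rw [Finset.disjoint_insert_left] at h
    rw [Finset.insert_union, zEx_insert _ _ _ (by simp [ha, h.1]), zEx_insert _ _ _ ha,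
      ih h.2, ih h.2]
    simp only [Finset.insert_union]

lemma zEx_mul_left {α : Type*} (p : ℝ) (E : Finset α) (c : ℝ) (f : Finset α → ℝ) :
    zEx p E (fun S => c * f S) = c * zEx p E f := by
  unfold zEx
  rw [Finset.mul_sum]
  apply Finset.sum_congr rfl
  intros; ring

lemma zEx_mul_right {α : Type*} (p : ℝ) (E : Finset α) (c : ℝ) (f : Finset α → ℝ) :
    zEx p E (fun S => f S * c) = zEx p E f * c := by
  unfold zEx
  rw [Finset.sum_mul]
  apply Finset.sum_congr rfl
  intros; ring

lemma zEx_card {α : Type*} (p : ℝ) (E : Finset α) (g : ℕ → ℝ) :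
    zEx p E (fun S => g S.card) = zSum p E.card g := by
  unfold zEx zSum
  rw [Finset.sum_powerset_apply_card (fun k => p ^ k * (1 - p) ^ (E.card - k) * g k)]
  apply Finset.sum_congr rfl
  intro k _
  simp only [zb, nsmul_eq_mul]; ring

lemma zSum_one (p : ℝ) (N : ℕ) : zSum p N (fun _ => 1) = 1 := by
  have := add_pow p (1 - p) N
  simp only [add_sub_cancel, one_pow] at this
  unfold zSum zb
  refine Eq.trans ?_ this.symm
  apply Finset.sum_congr rfl
  intros; ring

lemma zEx_const {α : Type*} (p : ℝ) (E : Finset α) (c : ℝ) : zEx p E (fun _ => c) = c := by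
  rw [zEx_card p E (fun _ => c)]
  have := zSum_one p E.card
  unfold zSum at *
  rw [← Finset.sum_mul]
  simp only [mul_one] at this
  rw [this, one_mul]

/-- one-block formula -/
lemma zEx_one {α : Type*} [DecidableEq α] (p : ℝ) (E A : Finset α) (hA : A ⊆ E) (g : ℕ → ℝ) :
    zEx p E (fun S => g (S ∩ A).card) = zSum p A.card g := by
  have hE : E = A ∪ (E \ A) := by rw [Finset.union_sdiff_of_subset hA]
  rw [hE, zEx_union _ _ _ Finset.disjoint_sdiff, ← zEx_card]
  apply zEx_congr
  intro S hS
  rw [zEx_congr p (E \ A) (g := fun _ => g S.card), zEx_const]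
  intro T hT
  congr 2
  ext x
  have := @hS x
  have := @hT x
  simp at *
  tauto

set_option maxHeartbeats 1600000 in
/-- two-block formula -/
lemma zEx_two {α : Type*} [DecidableEq α] (p : ℝ) (E A B : Finset α) (e : α) (he : e ∈ E) (hA : A ⊆ E) (hB : B ⊆ E)
    (heA : e ∉ A) (heB : e ∉ B) (hAB : Disjoint A B) (g h : ℕ → ℝ) :
    zEx p E (fun S => g (S ∩ insert e A).card * h (S ∩ insert e B).card) =
      p * (zSum p A.card (fun k => g (k + 1)) * zSum p B.card (fun k => h (k + 1))) +
      (1 - p) * (zSum p A.card g * zSum p B.card h) := by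
  set R := (E \ insert e (A ∪ B)) with hR
  have hE : E = insert e (A ∪ (B ∪ R)) := by
    ext x
    have := @hA x
    have := @hB x
    by_cases hx : x = e
    · subst hx; simp [he]
    · simp [hR, hx]; tauto
  have h1 : e ∉ A ∪ (B ∪ R) := by simp [heA, heB, hR]
  have h2 : Disjoint A (B ∪ R) := by
    rw [Finset.disjoint_union_right]
    refine ⟨hAB, ?_⟩
    rw [Finset.disjoint_left]; intro x hx; simp [hR, hx]
  have h3 : Disjoint B R := by
    rw [Finset.disjoint_left]; intro x hx; simp [hR, hx]
  have hAB' := Finset.disjoint_left.1 hAB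
  have hAR : ∀ x ∈ R, x ∉ A := by intro x hx; simp [hR] at hx; tauto
  have hBR : ∀ x ∈ R, x ∉ B := by intro x hx; simp [hR] at hx; tauto
  have heR : e ∉ R := by simp [hR]
  rw [hE, zEx_insert _ _ _ h1, zEx_union _ _ _ h2, zEx_union _ _ _ h2]
  congr 2
  · rw [← zEx_card p A, ← zEx_mul_right]
    apply zEx_congr
    intro S hS
    rw [zEx_union _ _ _ h3, ← zEx_card p B, ← zEx_mul_left]
    apply zEx_congr
    intro T hT
    rw [← zEx_const p R (g (S.card + 1) * h (T.card + 1))]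
    apply zEx_congr
    intro U hU
    have e1 : insert e (S ∪ (T ∪ U)) ∩ insert e A = insert e S := by
      ext x
      have := @hS x
      have := @hT x
      have := @hU x
      have := hAR x
      have := @hAB' x
      simp; tauto
    have e2 : insert e (S ∪ (T ∪ U)) ∩ insert e B = insert e T := by
      ext x
      have := @hS x
      have := @hT x
      have := @hU x
      have := hBR x
      have := @hAB' x
      simp; tauto
    rw [e1, e2, Finset.card_insert_of_notMem (fun h => heA (hS h)),
      Finset.card_insert_of_notMem (fun h => heB (hT h))]
  · rw [← zEx_card p A, ← zEx_mul_right]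
    apply zEx_congr
    intro S hS
    rw [zEx_union _ _ _ h3, ← zEx_card p B, ← zEx_mul_left]
    apply zEx_congr
    intro T hT
    rw [← zEx_const p R (g S.card * h T.card)]
    apply zEx_congr
    intro U hU
    have e1 : (S ∪ (T ∪ U)) ∩ insert e A = S := by
      ext x
      have := @hS x
      have := @hT x
      have := @hU x
      have := hAR x
      have := @hAB' x
      by_cases hx : x = e
      · subst hx; simp; tauto
      simp [hx]; tauto
    have e2 : (S ∪ (T ∪ U)) ∩ insert e B = T := by
      ext x
      have := @hS x
      have := @hT x
      have := @hU x
      have := hBR x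
      have := @hAB' x
      by_cases hx : x = e
      · subst hx; simp; tauto
      simp [hx]; tauto
    rw [e1, e2]

lemma grEx_eq (n : ℕ) (p : ℝ) (F : Finset (Sym2 (Fin n)) → ℝ) :
    grEx n p (fun G => F G.edgeFinset) = zEx p (⊤ : SimpleGraph (Fin n)).edgeFinset F := by
  unfold grEx zEx
  refine Finset.sum_bij (fun G _ => G.edgeFinset) ?_ ?_ ?_ ?_
  · intro G _
    rw [Finset.mem_powerset]
    exact SimpleGraph.edgeFinset_subset_edgeFinset.2 le_top
  · intro G _ H _ h
    exact SimpleGraph.edgeFinset_inj.1 h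
  · intro S hS
    refine ⟨SimpleGraph.fromEdgeSet (S : Set (Sym2 (Fin n))), Finset.mem_univ _, ?_⟩
    ext e
    have hS' : e ∈ S → e ∈ _ := fun h => Finset.mem_powerset.1 hS h
    simp at *
    tauto
  · intro G _
    unfold grWeight
    congr 3
    have := SimpleGraph.card_edgeFinset_top_eq_card_choose_two (V := Fin n)
    rw [Fintype.card_fin] at this
    rw [← this]

lemma deg_eq (n : ℕ) (G : SimpleGraph (Fin n)) (v : Fin n) :
    G.degree v = (G.edgeFinset ∩ (⊤ : SimpleGraph (Fin n)).incidenceFinset v).card := by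
  rw [← SimpleGraph.card_incidenceFinset_eq_degree]
  congr 1
  ext e
  simp [SimpleGraph.mem_incidenceFinset, SimpleGraph.incidenceSet]
  intro h _
  exact SimpleGraph.not_isDiag_of_mem_edgeSet G h

lemma inc_card (n : ℕ) (v : Fin n) :
    ((⊤ : SimpleGraph (Fin n)).incidenceFinset v).card = n - 1 := by
  rw [SimpleGraph.card_incidenceFinset_eq_degree]
  simp

lemma inc_sub (n : ℕ) (v : Fin n) :
    (⊤ : SimpleGraph (Fin n)).incidenceFinset v ⊆ (⊤ : SimpleGraph (Fin n)).edgeFinset :=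
  SimpleGraph.incidenceFinset_subset _ _

lemma grEx_deg (n : ℕ) (p : ℝ) (v : Fin n) (g : ℕ → ℝ) :
    grEx n p (fun G => g (G.degree v)) = zSum p (n - 1) g := by
  rw [← inc_card n v, ← zEx_one p _ _ (inc_sub n v) g, ← grEx_eq]
  simp only [deg_eq]
  
lemma grEx_deg2 (n : ℕ) (p : ℝ) (u v : Fin n) (huv : u ≠ v) (g h : ℕ → ℝ) :
    grEx n p (fun G => g (G.degree u) * h (G.degree v)) =
      p * (zSum p (n - 2) (fun k => g (k + 1)) * zSum p (n - 2) (fun k => h (k + 1))) +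
      (1 - p) * (zSum p (n - 2) g * zSum p (n - 2) h) := by
  set e : Sym2 (Fin n) := s(u, v) with he
  have hu : e ∈ (⊤ : SimpleGraph (Fin n)).incidenceFinset u := by
    simp [SimpleGraph.mem_incidenceFinset, SimpleGraph.incidenceSet, he, huv]
  have hv : e ∈ (⊤ : SimpleGraph (Fin n)).incidenceFinset v := by
    simp [SimpleGraph.mem_incidenceFinset, SimpleGraph.incidenceSet, he, huv]
  have cu : (((⊤ : SimpleGraph (Fin n)).incidenceFinset u).erase e).card = n - 2 := by
    rw [Finset.card_erase_of_mem hu, inc_card]; rfl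
  have cv : (((⊤ : SimpleGraph (Fin n)).incidenceFinset v).erase e).card = n - 2 := by
    rw [Finset.card_erase_of_mem hv, inc_card]; rfl
  have key := zEx_two p (⊤ : SimpleGraph (Fin n)).edgeFinset
    (((⊤ : SimpleGraph (Fin n)).incidenceFinset u).erase e)
    (((⊤ : SimpleGraph (Fin n)).incidenceFinset v).erase e) e (inc_sub n u hu)
    ((Finset.erase_subset _ _).trans (inc_sub n u)) ((Finset.erase_subset _ _).trans (inc_sub n v))
    (Finset.notMem_erase _ _) (Finset.notMem_erase _ _) (by
      rw [Finset.disjoint_left]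
      intro x hx hy
      simp [SimpleGraph.mem_incidenceFinset, SimpleGraph.incidenceSet] at hx hy
      apply hx.1
      rw [he]
      exact (Sym2.mem_and_mem_iff huv).1 ⟨hx.2.2, hy.2.2⟩) g h
  rw [cu, cv, Finset.insert_erase hu, Finset.insert_erase hv, ← grEx_eq] at key
  rw [← key]
  simp only [deg_eq]

noncomputable def zind (t : ℝ) (k : ℕ) : ℝ := if t < (k : ℝ) then 1 else 0

noncomputable def zthr (n : ℕ) (p : ℝ) : ℝ :=
  (n : ℝ) * p + Real.sqrt ((1 / 2) * n * p * (1 - p) * Real.log n)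

noncomputable def zP (n : ℕ) (p : ℝ) : ℝ := zSum p (n - 1) (zind (zthr n p))

lemma zeta_eq (n : ℕ) (p : ℝ) (G : SimpleGraph (Fin n)) :
    (zeta n p G : ℝ) = ∑ v : Fin n, zind (zthr n p) (G.degree v) := by
  unfold zeta zind zthr
  rw [Finset.card_filter]
  push_cast
  rfl

lemma grEx_sum {ι : Type*} (n : ℕ) (p : ℝ) (s : Finset ι) (f : ι → SimpleGraph (Fin n) → ℝ) :
    grEx n p (fun G => ∑ i ∈ s, f i G) = ∑ i ∈ s, grEx n p (f i) := by
  unfold grEx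
  simp only [Finset.mul_sum]
  rw [Finset.sum_comm]

lemma grEx_zeta (n : ℕ) (p : ℝ) :
    grEx n p (fun G => (zeta n p G : ℝ)) = n * zP n p := by
  simp only [zeta_eq]
  rw [grEx_sum]
  simp only [grEx_deg n p _ (zind (zthr n p))]
  simp [zP]

lemma zind_mul_self (t : ℝ) (k : ℕ) : zind t k * zind t k = zind t k := by
  unfold zind; split_ifs <;> simp

lemma zb_nonneg {p : ℝ} (hp0 : 0 < p) (hp1 : p < 1) (N k : ℕ) : 0 ≤ zb p N k := by
  unfold zb
  have : 0 ≤ 1 - p := by linarith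
  positivity

lemma zdiff_le {p : ℝ} (hp0 : 0 < p) (hp1 : p < 1) (N : ℕ) (t : ℝ) (ht : 0 ≤ t) :
    0 ≤ zSum p N (fun k => zind t (k + 1)) - zSum p N (zind t) ∧
    zSum p N (fun k => zind t (k + 1)) - zSum p N (zind t) ≤ zb p N ⌊t⌋₊ := by
  have h : zSum p N (fun k => zind t (k + 1)) - zSum p N (zind t) =
      ∑ k ∈ range (N + 1), if k = ⌊t⌋₊ then zb p N k else 0 := by
    unfold zSum
    rw [← Finset.sum_sub_distrib]
    apply Finset.sum_congr rfl
    intro k _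
    unfold zind
    beta_reduce
    by_cases hk : k = ⌊t⌋₊
    · have h1 := Nat.floor_le ht
      have h2 := Nat.lt_floor_add_one t
      rw [← hk] at h1 h2
      rw [if_pos (by push_cast; exact h2), if_neg (not_lt.2 h1), if_pos hk]
      ring
    · rw [if_neg hk]
      rcases lt_or_gt_of_ne hk with h | h
      · have h1 : ((k + 1 : ℕ) : ℝ) ≤ t := (Nat.le_floor_iff ht).1 h
        have h2 : (k : ℝ) ≤ t := by push_cast at h1; linarith
        rw [if_neg (not_lt.2 h1), if_neg (not_lt.2 h2)]; ring
      · have h1 : t < k := (Nat.floor_lt ht).1 h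
        rw [if_pos (by push_cast; linarith), if_pos h1]; ring
  rw [h]
  constructor
  · apply Finset.sum_nonneg
    intro k _
    split_ifs
    · exact zb_nonneg hp0 hp1 _ _
    · exact le_rfl
  · rw [Finset.sum_ite_eq']
    split_ifs
    · exact le_rfl
    · exact zb_nonneg hp0 hp1 _ _

lemma grEx_zeta_sq (n : ℕ) (p : ℝ) :
    grEx n p (fun G => (zeta n p G : ℝ) ^ 2) = n * zP n p + n * (n - 1) *
      (p * (zSum p (n - 2) (fun k => zind (zthr n p) (k + 1))) ^ 2 +
        (1 - p) * (zSum p (n - 2) (zind (zthr n p))) ^ 2) := by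
  simp only [zeta_eq, sq, Finset.sum_mul_sum]
  rw [grEx_sum]
  simp only [grEx_sum]
  have : ∀ u v : Fin n, grEx n p (fun G => zind (zthr n p) (G.degree u) * zind (zthr n p) (G.degree v))
     = (p * (zSum p (n - 2) (fun k => zind (zthr n p) (k + 1))) ^ 2 +
        (1 - p) * (zSum p (n - 2) (zind (zthr n p))) ^ 2) + if u = v then
        (zP n p - (p * (zSum p (n - 2) (fun k => zind (zthr n p) (k + 1))) ^ 2 +
        (1 - p) * (zSum p (n - 2) (zind (zthr n p))) ^ 2)) else 0 := by
    intro u v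
    split_ifs with h
    · subst h
      simp only [zind_mul_self]
      rw [grEx_deg n p u (zind (zthr n p))]
      simp [zP]
    · rw [grEx_deg2 n p u v h]; ring
  simp only [this, Finset.sum_add_distrib, Finset.sum_ite_eq, Finset.mem_univ, if_true]
  simp
  ring

lemma zP_eq (n : ℕ) (hn : 2 ≤ n) (p : ℝ) : zP n p =
    p * (zSum p (n - 2) (fun k => zind (zthr n p) (k + 1))) +
        (1 - p) * (zSum p (n - 2) (zind (zthr n p))) := by
  have h := grEx_deg2 n p ⟨0, by omega⟩ ⟨1, by omega⟩ (by simp) (zind (zthr n p)) (fun _ => 1)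
  simp only [mul_one, zSum_one] at h
  rw [← h, grEx_deg n p _ (zind (zthr n p)), zP]

lemma grEx_one (n : ℕ) (p : ℝ) : grEx n p (fun _ => 1) = 1 := by
  rw [grEx_eq n p (fun _ => 1), zEx_const]

lemma zthr_nonneg (n : ℕ) {p : ℝ} (hp0 : 0 < p) : 0 ≤ zthr n p := by
  unfold zthr; positivity

lemma zP_nonneg (n : ℕ) {p : ℝ} (hp0 : 0 < p) (hp1 : p < 1) : 0 ≤ zP n p := by
  unfold zP zSum
  apply Finset.sum_nonneg
  intro k _
  apply mul_nonneg (zb_nonneg hp0 hp1 _ _)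
  unfold zind; split_ifs <;> simp

lemma zvar (n : ℕ) (hn : 2 ≤ n) {p : ℝ} (hp0 : 0 < p) (hp1 : p < 1) :
    grEx n p (fun G => ((zeta n p G : ℝ) - n * zP n p) ^ 2) ≤
      n * zP n p + n ^ 2 * (zb p (n - 2) ⌊zthr n p⌋₊) ^ 2 := by
  have h1 : grEx n p (fun G => ((zeta n p G : ℝ) - n * zP n p) ^ 2) =
      grEx n p (fun G => (zeta n p G : ℝ) ^ 2) - 2 * (n * zP n p) * grEx n p (fun G => (zeta n p G : ℝ))
       + (n * zP n p) ^ 2 * grEx n p (fun _ => 1) := by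
    unfold grEx
    rw [Finset.mul_sum, Finset.mul_sum, ← Finset.sum_sub_distrib, ← Finset.sum_add_distrib]
    apply Finset.sum_congr rfl
    intros; ring
  rw [h1, grEx_one, grEx_zeta, grEx_zeta_sq]
  have hP := zP_eq n hn p
  obtain ⟨h2, h3⟩ := zdiff_le hp0 hp1 (n - 2) (zthr n p) (zthr_nonneg n hp0)
  set a := zSum p (n - 2) (fun k => zind (zthr n p) (k + 1))
  set b := zSum p (n - 2) (zind (zthr n p))
  set z := zb p (n - 2) ⌊zthr n p⌋₊
  have hn' : (2 : ℝ) ≤ n := by exact_mod_cast hn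
  have h4 : p * a ^ 2 + (1 - p) * b ^ 2 = zP n p ^ 2 + p * (1 - p) * (a - b) ^ 2 := by
    rw [hP]; ring
  rw [h4]
  have h5 : (a - b) ^ 2 ≤ z ^ 2 := pow_le_pow_left₀ h2 h3 2
  have h6 : p * (1 - p) ≤ 1 := by nlinarith
  have h7 : p * (1 - p) * (a - b) ^ 2 ≤ z ^ 2 := by nlinarith [sq_nonneg (a - b)]
  have h8 : (n : ℝ) * (n - 1) * (p * (1 - p) * (a - b) ^ 2) ≤ n ^ 2 * z ^ 2 := by
    apply mul_le_mul _ h7 _ (by positivity)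
    · nlinarith
    · have : 0 ≤ 1 - p := by linarith
      positivity
  have h9 : 0 ≤ (n : ℝ) * zP n p ^ 2 := by positivity
  nlinarith

lemma grWeight_nonneg (n : ℕ) {p : ℝ} (hp0 : 0 < p) (hp1 : p < 1) (G : SimpleGraph (Fin n)) :
    0 ≤ grWeight n p G := by
  unfold grWeight
  have : 0 ≤ 1 - p := by linarith
  positivity

lemma grPr_le_one (n : ℕ) {p : ℝ} (hp0 : 0 < p) (hp1 : p < 1) (A : Set (SimpleGraph (Fin n))) :
    grPr n p A ≤ 1 := by
  rw [← grEx_one n p]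
  unfold grPr grEx
  apply Finset.sum_le_sum
  intro G _
  have := grWeight_nonneg n hp0 hp1 G
  split_ifs <;> simp [this]

lemma zcheb (n : ℕ) (hn : 2 ≤ n) {p : ℝ} (hp0 : 0 < p) (hp1 : p < 1) (x : ℝ) (hx : x < n * zP n p) :
    1 - (n * zP n p + n ^ 2 * (zb p (n - 2) ⌊zthr n p⌋₊) ^ 2) / (n * zP n p - x) ^ 2 ≤
      grPr n p {G | x < (zeta n p G : ℝ)} := by
  have h0 : 0 < (n * zP n p - x) ^ 2 := by
    have : 0 < n * zP n p - x := by linarith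
    positivity
  have h1 : grEx n p (fun _ => 1) - grEx n p (fun G => ((zeta n p G : ℝ) - n * zP n p) ^ 2) /
      (n * zP n p - x) ^ 2 ≤ grPr n p {G | x < (zeta n p G : ℝ)} := by
    unfold grEx grPr
    rw [Finset.sum_div, ← Finset.sum_sub_distrib]
    apply Finset.sum_le_sum
    intro G _
    have := grWeight_nonneg n hp0 hp1 G
    simp only [Set.mem_ofPred_eq]
    split_ifs with h
    · have : 0 ≤ grWeight n p G * (↑(zeta n p G) - ↑n * zP n p) ^ 2 / (↑n * zP n p - x) ^ 2 := by
        positivity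
      linarith
    · rw [sub_nonpos, mul_one, le_div_iff₀ h0]
      apply mul_le_mul_of_nonneg_left _ this
      rw [not_lt] at h
      nlinarith
  rw [grEx_one] at h1
  refine le_trans ?_ h1
  apply sub_le_sub_left
  exact div_le_div_of_nonneg_right (zvar n hn hp0 hp1) h0.le

lemma zphi (u : ℝ) (hu : |u| ≤ 1 / 2) :
    |u ^ 2 / 2 + u - (1 + u) * Real.log (1 + u)| ≤ 4 * |u| ^ 3 := by
  have h := Real.abs_log_sub_add_sum_range_le (x := -u) (by rw [abs_neg]; linarith) 2
  simp only [Finset.sum_range_succ, Finset.sum_range_zero, abs_neg, sub_neg_eq_add] at h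
  norm_num at h
  have h2 : |u| ^ 3 / (1 - |u|) ≤ 2 * |u| ^ 3 := by
    rw [div_le_iff₀ (by linarith)]
    have : 0 ≤ |u| ^ 3 := by positivity
    nlinarith
  have h3 := h.trans h2
  set r := -u + u ^ 2 / 2 + Real.log (1 + u) with hr
  have e : u ^ 2 / 2 + u - (1 + u) * Real.log (1 + u) = u ^ 3 / 2 - (1 + u) * r := by
    rw [hr]; ring
  rw [e]
  have h4 : |1 + u| ≤ 3 / 2 := by
    have := abs_le.1 hu
    rw [abs_le]; constructor <;> linarith
  calc |u ^ 3 / 2 - (1 + u) * r| ≤ |u ^ 3 / 2| + |(1 + u) * r| := abs_sub _ _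
    _ = |u| ^ 3 / 2 + |1 + u| * |r| := by rw [abs_div, abs_pow, abs_mul]; norm_num
    _ ≤ |u| ^ 3 / 2 + 3 / 2 * (2 * |u| ^ 3) := by gcongr
    _ ≤ 4 * |u| ^ 3 := by nlinarith [pow_nonneg (abs_nonneg u) 3]

lemma zb_log {p : ℝ} (hp0 : 0 < p) (hp1 : p < 1) (N k : ℕ) (hk : 0 < k) (hkN : k < N) :
    Real.log (zb p N k) + 1 / 2 * Real.log (2 * Real.pi * N * p * (1 - p)) =
      (Real.log (Stirling.stirlingSeq N) - Real.log (Stirling.stirlingSeq k)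
        - Real.log (Stirling.stirlingSeq (N - k))) + 1 / 2 * Real.log Real.pi
      - 1 / 2 * Real.log (k / (N * p)) - 1 / 2 * Real.log ((N - k) / (N * (1 - p)))
      - k * Real.log (k / (N * p)) - (N - k) * Real.log ((N - k) / (N * (1 - p))) := by
  have hq : 0 < 1 - p := by linarith
  have hk' : (0 : ℝ) < k := by exact_mod_cast hk
  have hkN' : (0 : ℝ) < (N : ℝ) - k := by
    have : (k : ℝ) < N := by exact_mod_cast hkN
    linarith
  have hN : (0 : ℝ) < N := by linarith
  have hpi := Real.pi_pos
  rw [Stirling.log_stirlingSeq_formula, Stirling.log_stirlingSeq_formula,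
    Stirling.log_stirlingSeq_formula]
  have hz : zb p N k = (N.factorial : ℝ) / (k.factorial * (N - k).factorial) * p ^ k * (1 - p) ^ (N - k) := by
    unfold zb
    rw [Nat.cast_choose ℝ hkN.le]
  have f1 : (N.factorial : ℝ) ≠ 0 := by positivity
  have f2 : (k.factorial : ℝ) ≠ 0 := by positivity
  have f3 : ((N - k).factorial : ℝ) ≠ 0 := by positivity
  rw [hz, Real.log_mul (by positivity) (by positivity), Real.log_mul (by positivity) (by positivity),
    Real.log_div f1 (by positivity), Real.log_mul f2 f3, Real.log_pow, Real.log_pow,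
    Nat.cast_sub hkN.le]
  rw [Real.log_div hN.ne' (Real.exp_pos 1).ne', Real.log_div hk'.ne' (Real.exp_pos 1).ne', Real.log_div hkN'.ne' (Real.exp_pos 1).ne',
    Real.log_exp, Real.log_div hk'.ne' (by positivity), Real.log_div hkN'.ne' (by positivity)]
  rw [Real.log_mul hN.ne' hp0.ne', Real.log_mul hN.ne' hq.ne', 
    Real.log_mul (x := 2 * Real.pi * N * p) (by positivity) hq.ne',
    Real.log_mul (x := 2 * Real.pi * N) (by positivity) hp0.ne',
    Real.log_mul (x := 2 * Real.pi) (by positivity) hN.ne',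
    Real.log_mul (x := 2) (by positivity) hpi.ne',
    Real.log_mul (x := 2) (by positivity) hN.ne',
    Real.log_mul (x := 2) (by positivity) hk'.ne',
    Real.log_mul (x := 2) (by positivity) hkN'.ne']
  ring

lemma zlocal {p : ℝ} (hp0 : 0 < p) (hp1 : p < 1) (N k : ℕ → ℕ) (d : ℕ → ℝ)
    (hN : Tendsto N atTop atTop) (hd : ∀ n, d n = k n - N n * p)
    (h1 : Tendsto (fun n => d n / N n) atTop (nhds 0))
    (h2 : Tendsto (fun n => |d n| ^ 3 / (N n : ℝ) ^ 2) atTop (nhds 0)) :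
    Tendsto (fun n => zb p (N n) (k n) * Real.sqrt (2 * Real.pi * N n * p * (1 - p)) *
      Real.exp (d n ^ 2 / (2 * N n * p * (1 - p)))) atTop (nhds 1) := by
  have hq : 0 < 1 - p := by linarith
  have hpi := Real.pi_pos
  have hNR : Tendsto (fun n => (N n : ℝ)) atTop atTop := tendsto_natCast_atTop_atTop.comp hN
  have hNpos : ∀ᶠ n in atTop, (0 : ℝ) < N n := hNR.eventually_gt_atTop 0
  -- u, w
  have hu : Tendsto (fun n => d n / (N n * p)) atTop (nhds 0) := by
    have := h1.div_const p
    simpa [div_div] using this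
  have hw : Tendsto (fun n => -d n / (N n * (1 - p))) atTop (nhds 0) := by
    have := h1.neg.div_const (1 - p)
    simpa [div_div, neg_div] using this
  have hku : ∀ᶠ n in atTop, (k n : ℝ) / (N n * p) = 1 + d n / (N n * p) := by
    filter_upwards [hNpos] with n hn
    rw [hd]; field_simp; ring
  have hkw : ∀ᶠ n in atTop, ((N n : ℝ) - k n) / (N n * (1 - p)) = 1 + -d n / (N n * (1 - p)) := by
    filter_upwards [hNpos] with n hn
    rw [hd]; field_simp; ring
  have hk1 : Tendsto (fun n => (k n : ℝ) / (N n * p)) atTop (nhds 1) := by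
    have := hu.const_add 1
    rw [add_zero] at this
    exact this.congr' (hku.mono fun n h => h.symm)
  have hk2 : Tendsto (fun n => ((N n : ℝ) - k n) / (N n * (1 - p))) atTop (nhds 1) := by
    have := hw.const_add 1
    rw [add_zero] at this
    exact this.congr' (hkw.mono fun n h => h.symm)
  have hkR : Tendsto (fun n => (k n : ℝ)) atTop atTop := by
    have := hk1.pos_mul_atTop one_pos (hNR.atTop_mul_const hp0)
    refine this.congr' ?_
    filter_upwards [hNpos] with n hn
    field_simp
  have hkR2 : Tendsto (fun n => (N n : ℝ) - k n) atTop atTop := by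
    have := hk2.pos_mul_atTop one_pos (hNR.atTop_mul_const hq)
    refine this.congr' ?_
    filter_upwards [hNpos] with n hn
    field_simp
  have hk : Tendsto k atTop atTop := tendsto_natCast_atTop_iff.1 hkR
  have hkN : ∀ᶠ n in atTop, k n < N n := by
    filter_upwards [hkR2.eventually_gt_atTop 0] with n hn
    have : (k n : ℝ) < N n := by linarith
    exact_mod_cast this
  have hNk : Tendsto (fun n => N n - k n) atTop atTop := by
    apply tendsto_natCast_atTop_iff (R := ℝ).1
    refine hkR2.congr' ?_
    filter_upwards [hkN] with n hn
    simp [Nat.cast_sub hn.le]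
  have hst : Tendsto (fun n => Real.log (Stirling.stirlingSeq n)) atTop (nhds (Real.log (Real.sqrt Real.pi))) :=
    (Real.continuousAt_log (by positivity)).tendsto.comp Stirling.tendsto_stirlingSeq_sqrt_pi
  have hS : Tendsto (fun n => (Real.log (Stirling.stirlingSeq (N n)) - Real.log (Stirling.stirlingSeq (k n))
        - Real.log (Stirling.stirlingSeq (N n - k n))) + 1 / 2 * Real.log Real.pi) atTop (nhds 0) := by
    have := (((hst.comp hN).sub (hst.comp hk)).sub (hst.comp hNk)).add_const (1 / 2 * Real.log Real.pi)
    rw [Real.log_sqrt hpi.le] at this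
    have e0 : Real.log Real.pi / 2 - Real.log Real.pi / 2 - Real.log Real.pi / 2
        + 1 / 2 * Real.log Real.pi = 0 := by ring
    rw [e0] at this
    exact this
  have hl1 : Tendsto (fun n => 1 / 2 * Real.log ((k n : ℝ) / (N n * p))) atTop (nhds 0) := by
    have := ((Real.continuousAt_log one_ne_zero).tendsto.comp hk1).const_mul (1 / 2)
    simpa using this
  have hl2 : Tendsto (fun n => 1 / 2 * Real.log (((N n : ℝ) - k n) / (N n * (1 - p)))) atTop (nhds 0) := by
    have := ((Real.continuousAt_log one_ne_zero).tendsto.comp hk2).const_mul (1 / 2)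
    simpa using this
  have hE : Tendsto (fun n => d n ^ 2 / (2 * N n * p * (1 - p)) - k n * Real.log (k n / (N n * p))
      - (N n - k n) * Real.log ((N n - k n) / (N n * (1 - p)))) atTop (nhds 0) := by
    have hb : Tendsto (fun n => (4 / p ^ 2 + 4 / (1 - p) ^ 2) * (|d n| ^ 3 / (N n : ℝ) ^ 2)) atTop (nhds 0) := by
      simpa using h2.const_mul (4 / p ^ 2 + 4 / (1 - p) ^ 2)
    apply squeeze_zero_norm' _ hb
    have hu' := (hu.abs).eventually_le_const (u := 1 / 2) (by norm_num)
    have hw' := (hw.abs).eventually_le_const (u := 1 / 2) (by norm_num)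
    filter_upwards [hku, hkw, hNpos, hu', hw'] with n hku hkw hn hu hw
    have b1 := zphi _ hu
    have b2 := zphi _ hw
    rw [hku, hkw]
    set u := d n / (N n * p) with hu_def
    set w := -d n / (N n * (1 - p)) with hw_def
    have e1 : (k n : ℝ) = N n * p * (1 + u) := by
      rw [← hku]; field_simp
    have e2 : (N n : ℝ) - k n = N n * (1 - p) * (1 + w) := by
      rw [← hkw]; field_simp
    have e3 : d n ^ 2 / (2 * N n * p * (1 - p)) - k n * Real.log (1 + u)
      - (N n - k n) * Real.log (1 + w) = N n * p * (u ^ 2 / 2 + u - (1 + u) * Real.log (1 + u))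
        + N n * (1 - p) * (w ^ 2 / 2 + w - (1 + w) * Real.log (1 + w)) := by
      rw [e2, e1]
      have e4 : d n ^ 2 / (2 * N n * p * (1 - p)) = N n * p * (u ^ 2 / 2 + u) + N n * (1 - p) * (w ^ 2 / 2 + w) := by
        rw [hu_def, hw_def]; field_simp; ring
      rw [e4]; ring
    have e5 : |u| ^ 3 = |d n| ^ 3 / (N n * p) ^ 3 := by
      rw [hu_def, abs_div, div_pow, abs_of_pos (show 0 < N n * p by positivity)]
    have e6 : |w| ^ 3 = |d n| ^ 3 / (N n * (1 - p)) ^ 3 := by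
      rw [hw_def, abs_div, abs_neg, div_pow, abs_of_pos (show 0 < N n * (1 - p) by positivity)]
    rw [e3, Real.norm_eq_abs]
    refine (abs_add_le _ _).trans ?_
    rw [abs_mul (N n * p), abs_mul (N n * (1 - p)), abs_of_pos (show 0 < N n * p by positivity),
      abs_of_pos (show 0 < N n * (1 - p) by positivity)]
    calc _ ≤ N n * p * (4 * |u| ^ 3) + N n * (1 - p) * (4 * |w| ^ 3) := by gcongr
      _ = _ := by rw [e5, e6]; field_simp
  have hL := (((hS.sub hl1).sub hl2).add hE)
  simp only [sub_zero, add_zero] at hL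
  have := (Real.continuous_exp.tendsto 0).comp hL
  rw [Real.exp_zero] at this
  refine this.congr' ?_
  filter_upwards [hNpos, hkN, hk.eventually_gt_atTop 0] with n hn hkN hk0
  have hz : 0 < zb p (N n) (k n) := by
    unfold zb
    have : 0 < (N n).choose (k n) := Nat.choose_pos hkN.le
    positivity
  have hX : 0 < 2 * Real.pi * N n * p * (1 - p) := by positivity
  have key := zb_log hp0 hp1 (N n) (k n) hk0 hkN
  simp only [Function.comp]
  rw [← Real.exp_log hz, ← Real.exp_log (Real.sqrt_pos.2 hX), Real.log_sqrt hX.le, ← Real.exp_add,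
    ← Real.exp_add]
  congr 1
  linarith

lemma zb_zero {p : ℝ} (N k : ℕ) (h : N < k) : zb p N k = 0 := by
  unfold zb; rw [Nat.choose_eq_zero_of_lt h]; simp

lemma zb_ratio (p : ℝ) (N k : ℕ) :
    ((k : ℝ) + 1) * (1 - p) * zb p N (k + 1) = ((N : ℝ) - k) * p * zb p N k := by
  rcases lt_trichotomy k N with h | h | h
  · have h1 := Nat.choose_succ_right_eq N k
    have h2 : (N.choose (k + 1) : ℝ) * (k + 1) = N.choose k * ((N : ℝ) - k) := by
      have : ((N.choose (k + 1) * (k + 1) : ℕ) : ℝ) = ((N.choose k * (N - k) : ℕ) : ℝ) := by rw [h1]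
      push_cast [Nat.cast_sub h.le] at this
      exact this
    unfold zb
    have h3 : N - k = (N - (k + 1)) + 1 := by omega
    rw [h3, pow_succ, pow_succ]
    linear_combination (p ^ k * p * (1 - p) ^ (N - (k + 1)) * (1 - p)) * h2
  · subst h
    rw [zb_zero _ _ (Nat.lt_succ_self _)]; ring
  · rw [zb_zero _ _ h, zb_zero _ _ (h.trans (Nat.lt_succ_self _))]; ring

lemma zb_tele (p : ℝ) (N k m : ℕ) :
    ∑ j ∈ range m, ((k : ℝ) + j - N * p) * zb p N (k + j) =
      k * (1 - p) * zb p N k - ((k : ℝ) + m) * (1 - p) * zb p N (k + m) := by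
  induction m with
  | zero => simp
  | succ m ih =>
    rw [Finset.sum_range_succ, ih]
    have := zb_ratio p N (k + m)
    push_cast at *
    rw [← add_assoc, ← add_assoc, this]
    ring

lemma zT_eq (p : ℝ) (N k : ℕ) (t : ℝ) (ht : 0 ≤ t) (hk : k = ⌊t⌋₊ + 1) :
    zSum p N (zind t) = ∑ j ∈ range (N + 1), zb p N (k + j) := by
  have h1 : zSum p N (zind t) = ∑ i ∈ range (k + (N + 1)), zb p N i * zind t i := by
    unfold zSum
    apply Finset.sum_subset
    · intro i; simp; omega
    · intro i _ hi
      rw [zb_zero _ _ (by simp at hi; omega)]; simp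
  rw [h1, Finset.sum_range_add]
  have h2 : ∑ i ∈ range k, zb p N i * zind t i = 0 := by
    apply Finset.sum_eq_zero
    intro i hi
    have : (i : ℝ) ≤ t := (Nat.le_floor_iff ht).1 (by simp at hi; omega)
    simp [zind, not_lt.2 this]
  rw [h2, zero_add]
  apply Finset.sum_congr rfl
  intro j _
  have : t < ((k + j : ℕ) : ℝ) := (Nat.floor_lt ht).1 (by omega)
  unfold zind
  rw [if_pos this, mul_one]

lemma zT_upper {p : ℝ} (hp0 : 0 < p) (hp1 : p < 1) (N k : ℕ) (t : ℝ) (ht : 0 ≤ t)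
    (hk : k = ⌊t⌋₊ + 1) :
    zSum p N (zind t) * (k - N * p) ≤ k * (1 - p) * zb p N k := by
  rw [zT_eq p N k t ht hk]
  have h := zb_tele p N k (N + 1)
  rw [zb_zero N (k + (N + 1)) (by omega), mul_zero, sub_zero] at h
  rw [← h, Finset.sum_mul]
  apply Finset.sum_le_sum
  intro j _
  rw [mul_comm]
  apply mul_le_mul_of_nonneg_right _ (zb_nonneg hp0 hp1 _ _)
  have : (0 : ℝ) ≤ j := Nat.cast_nonneg j
  linarith

lemma zT_lower {p : ℝ} (hp0 : 0 < p) (hp1 : p < 1) (N k J : ℕ) (t : ℝ) (ht : 0 ≤ t)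
    (hk : k = ⌊t⌋₊ + 1) (hJ : J ≤ N + 1) (hd : 0 ≤ (k : ℝ) + J - N * p) :
    k * (1 - p) * zb p N k - ((k : ℝ) + J) * (1 - p) * zb p N (k + J) ≤
      zSum p N (zind t) * (k + J - N * p) := by
  rw [zT_eq p N k t ht hk, ← zb_tele]
  calc _ ≤ (∑ j ∈ range J, zb p N (k + j)) * (k + J - N * p) := by
        rw [Finset.sum_mul]
        apply Finset.sum_le_sum
        intro j hj
        rw [mul_comm]
        apply mul_le_mul_of_nonneg_left _ (zb_nonneg hp0 hp1 _ _)
        have : (j : ℝ) ≤ J := by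
          have := (Finset.mem_range.1 hj).le
          exact_mod_cast this
        linarith
    _ ≤ _ := by
        apply mul_le_mul_of_nonneg_right _ hd
        apply Finset.sum_le_sum_of_subset_of_nonneg
        · intro i; simp; omega
        · intros; exact zb_nonneg hp0 hp1 _ _

lemma zmd {p : ℝ} (hp0 : 0 < p) (hp1 : p < 1) (N k : ℕ → ℕ) (t d : ℕ → ℝ)
    (ht : ∀ n, 0 ≤ t n) (hk : ∀ n, k n = ⌊t n⌋₊ + 1)
    (hN : Tendsto N atTop atTop) (hd : ∀ n, d n = k n - N n * p)
    (h0 : Tendsto (fun n => d n / Real.sqrt (N n)) atTop atTop)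
    (h1 : Tendsto (fun n => d n / N n) atTop (nhds 0))
    (h2 : Tendsto (fun n => |d n| ^ 3 / (N n : ℝ) ^ 2) atTop (nhds 0)) :
    Tendsto (fun n => zSum p (N n) (zind (t n)) * d n * Real.sqrt (2 * Real.pi) /
      Real.sqrt (N n * p * (1 - p)) *
      Real.exp (d n ^ 2 / (2 * N n * p * (1 - p)))) atTop (nhds 1) := by
  have hq : 0 < 1 - p := by linarith
  have hpi := Real.pi_pos
  have hNR : Tendsto (fun n => (N n : ℝ)) atTop atTop := tendsto_natCast_atTop_atTop.comp hN
  have hN1 : ∀ᶠ n in atTop, (1 : ℝ) ≤ N n := hNR.eventually_ge_atTop 1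
  have hd1 : ∀ᶠ n in atTop, Real.sqrt (N n) ≤ d n := by
    filter_upwards [hN1, h0.eventually_ge_atTop 1] with n hn h
    rwa [le_div_iff₀ (by positivity), one_mul] at h
  set J : ℕ → ℕ := fun n => ⌈Real.sqrt (N n)⌉₊ with hJ
  have hJ1 : ∀ n, Real.sqrt (N n) ≤ J n := fun n => Nat.le_ceil _
  have hJ2 : ∀ n, (J n : ℝ) ≤ Real.sqrt (N n) + 1 := fun n => (Nat.ceil_lt_add_one (Real.sqrt_nonneg _)).le
  have hJN : ∀ n, J n ≤ N n + 1 := by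
    intro n
    apply Nat.ceil_le.2
    have := Real.sq_sqrt (Nat.cast_nonneg (α := ℝ) (N n))
    push_cast
    nlinarith [sq_nonneg (Real.sqrt (N n) - 1)]
  have hJd : ∀ᶠ n in atTop, (J n : ℝ) ≤ 2 * Real.sqrt (N n) := by
    filter_upwards [hN1] with n hn
    have : 1 ≤ Real.sqrt (N n) := Real.one_le_sqrt.2 hn
    linarith [hJ2 n]
  have hb : ∀ᶠ n in atTop, |d n + J n| ≤ 3 * |d n| := by
    filter_upwards [hJd, hd1] with n a b
    have := Real.sqrt_nonneg (N n : ℝ)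
    rw [abs_of_nonneg (by linarith), abs_of_nonneg (by linarith [hJ1 n])]
    linarith
  have L1 := zlocal hp0 hp1 N k d hN hd h1 h2
  have L2 := zlocal hp0 hp1 N (fun n => k n + J n) (fun n => d n + J n) hN
    (by intro n; simp only [hd]; push_cast; ring)
    (by
      have := (h1.abs.const_mul 3)
      rw [abs_zero, mul_zero] at this
      apply squeeze_zero_norm' _ this
      filter_upwards [hb] with n h
      rw [Real.norm_eq_abs, abs_div, abs_div, ← mul_div_assoc]
      gcongr)
    (by
      have := (h2.const_mul 27)
      rw [mul_zero] at this
      apply squeeze_zero' _ _ this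
      · exact Eventually.of_forall fun n => by positivity
      · filter_upwards [hb] with n h
        rw [← mul_div_assoc]
        have : |d n + J n| ^ 3 ≤ (3 * |d n|) ^ 3 := by gcongr
        have e : (3 * |d n|) ^ 3 = 27 * |d n| ^ 3 := by ring
        rw [← e]
        gcongr)
  -- exponential ratio
  have hX : Tendsto (fun n => Real.exp (-((2 * d n * J n + J n ^ 2) / (2 * N n * p * (1 - p))))) atTop (nhds 0) := by
    apply Real.tendsto_exp_neg_atTop_nhds_zero.comp
    have hh : Tendsto (fun n => d n / Real.sqrt (N n) * (1 / (p * (1 - p)))) atTop atTop :=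
      h0.atTop_mul_const (by positivity)
    apply tendsto_atTop_mono' _ _ hh
    filter_upwards [hN1, hd1] with n hn hdn
    have hs : 0 < Real.sqrt (N n) := by positivity
    have hss := Real.mul_self_sqrt (Nat.cast_nonneg (α := ℝ) (N n))
    have hdp : 0 < d n := by linarith
    calc d n / Real.sqrt (N n) * (1 / (p * (1 - p)))
        = (2 * d n * Real.sqrt (N n)) / (2 * (Real.sqrt (N n) * Real.sqrt (N n)) * p * (1 - p)) := by
          field_simp
      _ = (2 * d n * Real.sqrt (N n)) / (2 * N n * p * (1 - p)) := by rw [hss]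
      _ ≤ _ := by
          gcongr
          have := hJ1 n
          nlinarith [sq_nonneg (J n : ℝ)]
  have hbr : Tendsto (fun n => zb p (N n) (k n + J n) / zb p (N n) (k n)) atTop (nhds 0) := by
    have := (L2.div L1 one_ne_zero).mul hX
    rw [mul_zero] at this
    refine this.congr' ?_
    filter_upwards [hN1] with n hn
    simp only [Pi.div_apply]
    have e : (d n + J n) ^ 2 / (2 * N n * p * (1 - p)) = d n ^ 2 / (2 * N n * p * (1 - p)) +
      (2 * d n * J n + J n ^ 2) / (2 * N n * p * (1 - p)) := by ring
    rw [e, Real.exp_add, Real.exp_neg]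
    have e1 := (Real.exp_pos (d n ^ 2 / (2 * N n * p * (1 - p)))).ne'
    have e2 := (Real.exp_pos ((2 * d n * J n + J n ^ 2) / (2 * N n * p * (1 - p)))).ne'
    have e3 : Real.sqrt (2 * Real.pi * N n * p * (1 - p)) ≠ 0 := by positivity
    generalize Real.exp (d n ^ 2 / (2 * N n * p * (1 - p))) = x1 at *
    generalize Real.exp ((2 * d n * J n + J n ^ 2) / (2 * N n * p * (1 - p))) = x2 at *
    generalize Real.sqrt (2 * Real.pi * N n * p * (1 - p)) = x3 at *
    by_cases hz : zb p (N n) (k n) = 0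
    · simp [hz]
    · field_simp
  have hzpos : ∀ᶠ n in atTop, 0 < zb p (N n) (k n) := by
    filter_upwards [L1.eventually_ne one_ne_zero] with n hn
    apply lt_of_le_of_ne (zb_nonneg hp0 hp1 _ _)
    intro h
    apply hn
    rw [← h]; ring
  have hdpos : ∀ᶠ n in atTop, 0 < d n := by
    filter_upwards [hN1, hd1] with n hn hdn
    have hs : 0 < Real.sqrt (N n) := by positivity
    linarith
  -- J / d → 0
  have hJd0 : Tendsto (fun n => (J n : ℝ) / d n) atTop (nhds 0) := by
    have := (h0.inv_tendsto_atTop).const_mul 2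
    rw [mul_zero] at this
    apply squeeze_zero' _ _ this
    · filter_upwards [hdpos] with n h
      positivity
    · filter_upwards [hdpos, hJd] with n h h'
      simp only [Pi.inv_apply, inv_div]
      rw [← mul_div_assoc]
      gcongr
  have hkp : ∀ n, (0 : ℝ) < k n := by intro n; rw [hk]; positivity
  have hJk0 : Tendsto (fun n => (J n : ℝ) / k n) atTop (nhds 0) := by
    apply squeeze_zero' _ _ hJd0
    · exact Eventually.of_forall fun n => by positivity
    · filter_upwards [hdpos] with n h
      have : d n ≤ k n := by rw [hd]; linarith [show 0 ≤ N n * p by positivity]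
      gcongr
  have hR : Tendsto (fun n => zSum p (N n) (zind (t n)) * d n / (k n * (1 - p) * zb p (N n) (k n)))
      atTop (nhds 1) := by
    have hlow : Tendsto (fun n => (1 + (J n : ℝ) / d n)⁻¹ * (1 - (1 + (J n : ℝ) / k n) *
        (zb p (N n) (k n + J n) / zb p (N n) (k n)))) atTop (nhds 1) := by
      have := ((hJd0.const_add 1).inv₀ (by norm_num)).mul (((hJk0.const_add 1).mul hbr).const_sub 1)
      simpa using this
    apply tendsto_of_tendsto_of_tendsto_of_le_of_le' hlow tendsto_const_nhds
    · filter_upwards [hdpos, hzpos] with n hdn hz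
      have key := zT_lower hp0 hp1 (N n) (k n) (J n) (t n) (ht n) (hk n) (hJN n) (by
        have := hd n
        have : (0 : ℝ) ≤ J n := Nat.cast_nonneg _
        linarith)
      have e : (k n : ℝ) + J n - N n * p = d n + J n := by rw [hd]; ring
      rw [e] at key
      have hk0 := hkp n
      have hdJ : 0 < d n + J n := by positivity
      rw [le_div_iff₀ (by positivity)]
      have e2 : (1 + (J n : ℝ) / d n)⁻¹ * (1 - (1 + (J n : ℝ) / k n) *
        (zb p (N n) (k n + J n) / zb p (N n) (k n))) * (k n * (1 - p) * zb p (N n) (k n)) =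
        (k n * (1 - p) * zb p (N n) (k n) - ((k n : ℝ) + J n) * (1 - p) * zb p (N n) (k n + J n)) /
          (d n + J n) * d n := by
        field_simp
      rw [e2]
      apply mul_le_mul_of_nonneg_right _ hdn.le
      rw [div_le_iff₀ hdJ]
      exact key
    · filter_upwards [hzpos] with n hz
      have hk0 := hkp n
      rw [div_le_one (by positivity), hd]
      exact zT_upper hp0 hp1 (N n) (k n) (t n) (ht n) (hk n)
  have hk1 : Tendsto (fun n => (k n : ℝ) / (N n * p)) atTop (nhds 1) := by
    have := (h1.div_const p).const_add 1
    rw [zero_div, add_zero] at this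
    refine this.congr' ?_
    filter_upwards [hN1] with n hn
    rw [hd]; field_simp; ring
  have := (hR.mul hk1).mul L1
  rw [mul_one, mul_one] at this
  refine this.congr' ?_
  filter_upwards [hzpos, hN1] with n hz hn
  have hk0 := hkp n
  have hX : 0 < N n * p * (1 - p) := by positivity
  have e : Real.sqrt (2 * Real.pi * N n * p * (1 - p)) = Real.sqrt (2 * Real.pi) * Real.sqrt (N n * p * (1 - p)) := by
    rw [← Real.sqrt_mul (by positivity)]; congr 1; ring
  have e2 : N n * p * (1 - p) = Real.sqrt (N n * p * (1 - p)) * Real.sqrt (N n * p * (1 - p)) :=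
    (Real.mul_self_sqrt hX.le).symm
  rw [e]
  have hs : 0 < Real.sqrt (N n * p * (1 - p)) := Real.sqrt_pos.2 hX
  rw [← mul_assoc]
  congr 1
  have e3 : zSum p (N n) (zind (t n)) * d n / (k n * (1 - p) * zb p (N n) (k n)) * (k n / (N n * p)) *
    (zb p (N n) (k n) * (Real.sqrt (2 * Real.pi) * Real.sqrt (N n * p * (1 - p)))) =
    zSum p (N n) (zind (t n)) * d n * Real.sqrt (2 * Real.pi) * Real.sqrt (N n * p * (1 - p)) / (N n * p * (1 - p)) := by
    generalize Real.sqrt (N n * p * (1 - p)) = s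
    field_simp
  rw [e3, div_eq_div_iff hX.ne' hs.ne']
  linear_combination (-(zSum p (N n) (zind (t n)) * d n * Real.sqrt (2 * Real.pi))) * e2

noncomputable def zs (p : ℝ) (n : ℕ) : ℝ := Real.sqrt ((1 / 2) * n * p * (1 - p) * Real.log n)

lemma zL_top : Tendsto (fun n : ℕ => Real.log (n : ℝ)) atTop atTop :=
  Real.tendsto_log_atTop.comp tendsto_natCast_atTop_atTop

lemma zL_pow (m : ℕ) : Tendsto (fun n : ℕ => Real.log (n : ℝ) ^ m / n) atTop (nhds 0) :=
  (Real.isLittleO_pow_log_id_atTop (n := m)).tendsto_div_nhds_zero.comp tendsto_natCast_atTop_atTop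

lemma zs_div_sqrt {p : ℝ} (hp0 : 0 < p) (hp1 : p < 1) :
    Tendsto (fun n : ℕ => zs p n / Real.sqrt n) atTop atTop := by
  have hq : 0 < 1 - p := by linarith
  have h : Tendsto (fun n : ℕ => Real.sqrt (1 / 2 * p * (1 - p) * Real.log n)) atTop atTop :=
    Real.tendsto_sqrt_atTop.comp (zL_top.const_mul_atTop (by positivity))
  refine h.congr' ?_
  filter_upwards [eventually_gt_atTop 0] with n hn
  have hn' : (0 : ℝ) < n := by exact_mod_cast hn
  unfold zs
  rw [← Real.sqrt_div' _ hn'.le]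
  congr 1
  field_simp

lemma zs_top {p : ℝ} (hp0 : 0 < p) (hp1 : p < 1) : Tendsto (zs p) atTop atTop := by
  apply tendsto_atTop_mono' _ _ (zs_div_sqrt hp0 hp1)
  filter_upwards [eventually_gt_atTop 0] with n hn
  have hn' : (1 : ℝ) ≤ n := by exact_mod_cast hn
  exact div_le_self (Real.sqrt_nonneg _) (Real.one_le_sqrt.2 hn')

lemma zs_div {p : ℝ} (hp0 : 0 < p) (hp1 : p < 1) :
    Tendsto (fun n : ℕ => zs p n / n) atTop (nhds 0) := by
  have h := ((zL_pow 1).const_mul (1 / 2 * p * (1 - p))).sqrt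
  rw [mul_zero, Real.sqrt_zero] at h
  refine h.congr' ?_
  filter_upwards [eventually_gt_atTop 0] with n hn
  have hn' : (0 : ℝ) < n := by exact_mod_cast hn
  unfold zs
  nth_rewrite 5 [← Real.sqrt_sq hn'.le]
  rw [← Real.sqrt_div' _ (by positivity)]
  congr 1
  field_simp

lemma zs_cube {p : ℝ} (hp0 : 0 < p) (hp1 : p < 1) :
    Tendsto (fun n : ℕ => zs p n ^ 3 / (n : ℝ) ^ 2) atTop (nhds 0) := by
  have h := ((zL_pow 3).const_mul ((1 / 2 * p * (1 - p)) ^ 3)).sqrt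
  rw [mul_zero, Real.sqrt_zero] at h
  refine h.congr' ?_
  filter_upwards [eventually_gt_atTop 0] with n hn
  have hn' : (1 : ℝ) ≤ n := by exact_mod_cast hn
  have hL := Real.log_nonneg hn'
  have hq : 0 < 1 - p := by linarith
  have hz : 0 ≤ zs p n := Real.sqrt_nonneg _
  rw [Real.sqrt_eq_iff_mul_self_eq (by positivity) (by positivity)]
  have : zs p n ^ 2 = (1 / 2) * n * p * (1 - p) * Real.log n := Real.sq_sqrt (by positivity)
  have e : zs p n ^ 3 / (n : ℝ) ^ 2 * (zs p n ^ 3 / (n : ℝ) ^ 2) = (zs p n ^ 2) ^ 3 / (n : ℝ) ^ 4 := by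
    field_simp
  rw [e, this]
  field_simp

lemma zd_lims {p : ℝ} (hp0 : 0 < p) (hp1 : p < 1) (j : ℕ) (d : ℕ → ℝ)
    (hd : ∀ᶠ n in atTop, |d n - zs p n| ≤ 2) :
    Tendsto (fun n => d n / ((n - j : ℕ) : ℝ)) atTop (nhds 0) ∧
    Tendsto (fun n => |d n| ^ 3 / ((n - j : ℕ) : ℝ) ^ 2) atTop (nhds 0) := by
  have hb : ∀ᶠ n in atTop, |d n| ≤ 3 * zs p n := by
    filter_upwards [hd, (zs_top hp0 hp1).eventually_ge_atTop 1] with n h1 h2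
    have := abs_le.1 h1
    rw [abs_le]
    constructor <;> linarith
  have hN : ∀ᶠ n : ℕ in atTop, (n : ℝ) / 2 ≤ ((n - j : ℕ) : ℝ) ∧ (0 : ℝ) < n := by
    filter_upwards [eventually_ge_atTop (2 * j + 1)] with n hn
    rw [Nat.cast_sub (by omega)]
    have : ((2 * j + 1 : ℕ) : ℝ) ≤ n := by exact_mod_cast hn
    push_cast at this
    constructor
    · linarith
    · have : (0 : ℝ) ≤ j := Nat.cast_nonneg _
      linarith
  constructor
  · have h := (zs_div hp0 hp1).const_mul 6
    rw [mul_zero] at h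
    apply squeeze_zero_norm' _ h
    filter_upwards [hb, hN] with n h1 ⟨h2, h3⟩
    rw [Real.norm_eq_abs, abs_div, abs_of_nonneg (Nat.cast_nonneg (α := ℝ) (n - j))]
    calc |d n| / ((n - j : ℕ) : ℝ) ≤ 3 * zs p n / (n / 2) := by
          have : 0 ≤ zs p n := Real.sqrt_nonneg _
          gcongr
      _ = _ := by field_simp; ring
  · have h := (zs_cube hp0 hp1).const_mul 108
    rw [mul_zero] at h
    apply squeeze_zero' _ _ h
    · exact Eventually.of_forall fun n => by positivity
    filter_upwards [hb, hN] with n h1 ⟨h2, h3⟩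
    calc |d n| ^ 3 / ((n - j : ℕ) : ℝ) ^ 2 ≤ (3 * zs p n) ^ 3 / (n / 2) ^ 2 := by
          have : 0 ≤ zs p n := Real.sqrt_nonneg _
          gcongr
      _ = _ := by field_simp; ring

lemma zsub_top (j : ℕ) : Tendsto (fun n : ℕ => n - j) atTop atTop := tendsto_sub_atTop_nat j

lemma zrep (n : ℕ) (hn : 2 ≤ n) :
    Real.sqrt ((n : ℝ) ^ ((3 : ℝ) / 2) / (Real.pi * Real.log n)) =
      Real.exp (Real.log n / 4) ^ 3 / Real.sqrt (Real.pi * Real.log n) ∧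
    Real.sqrt ((n : ℝ) / (Real.pi * Real.log n)) =
      Real.exp (Real.log n / 4) ^ 2 / Real.sqrt (Real.pi * Real.log n) ∧
    (n : ℝ) = Real.exp (Real.log n / 4) ^ 4 := by
  have hn' : (2 : ℝ) ≤ n := by exact_mod_cast hn
  have hn0 : (0 : ℝ) < n := by linarith
  have hL : 0 < Real.log n := Real.log_pos (by linarith)
  have hpi := Real.pi_pos
  have e1 : (n : ℝ) = Real.exp (Real.log n / 4) ^ 4 := by
    rw [← Real.exp_nat_mul]
    push_cast
    rw [mul_div_cancel₀ _ (by norm_num), Real.exp_log hn0]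
  have e2 : (n : ℝ) ^ ((3 : ℝ) / 2) = (Real.exp (Real.log n / 4) ^ 3) ^ 2 := by
    rw [Real.rpow_def_of_pos hn0, ← pow_mul, ← Real.exp_nat_mul]
    congr 1; push_cast; ring
  refine ⟨?_, ?_, e1⟩
  · rw [e2, Real.sqrt_div (by positivity), Real.sqrt_sq (by positivity)]
  · have e3 : (n : ℝ) = (Real.exp (Real.log n / 4) ^ 2) ^ 2 := by
      rw [← pow_mul]; exact e1
    have e4 : Real.sqrt (n : ℝ) = Real.exp (Real.log n / 4) ^ 2 := by
      conv_lhs => rw [e3]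
      rw [Real.sqrt_sq (by positivity)]
    rw [Real.sqrt_div (by positivity), e4]

lemma zthr_eq (n : ℕ) (p : ℝ) : zthr n p = n * p + zs p n := rfl

lemma zmean {p : ℝ} (hp0 : 0 < p) (hp1 : p < 1) :
    Tendsto (fun n : ℕ => (n : ℝ) * zP n p /
          Real.sqrt ((n : ℝ) ^ ((3 : ℝ) / 2) / (Real.pi * Real.log n))) atTop (nhds 1) := by
  have hq : 0 < 1 - p := by linarith
  have hpi := Real.pi_pos
  set k : ℕ → ℕ := fun n => ⌊zthr n p⌋₊ + 1 with hk
  set d : ℕ → ℝ := fun n => k n - ((n - 1 : ℕ) : ℝ) * p with hd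
  have hds : ∀ᶠ n in atTop, 0 ≤ d n - zs p n ∧ d n - zs p n ≤ 2 := by
    filter_upwards [eventually_ge_atTop 1] with n hn
    have h1 := Nat.floor_le (zthr_nonneg n hp0)
    have h2 := Nat.lt_floor_add_one (zthr n p)
    simp only [hd, hk]
    rw [Nat.cast_sub hn]
    rw [zthr_eq] at *
    push_cast
    constructor <;> nlinarith
  have hds' : ∀ᶠ n in atTop, |d n - zs p n| ≤ 2 := by
    filter_upwards [hds] with n h
    rw [abs_of_nonneg h.1]; exact h.2
  obtain ⟨h1, h2⟩ := zd_lims hp0 hp1 1 d hds'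
  have hNn : ∀ᶠ n : ℕ in atTop, (n : ℝ) = ((n - 1 : ℕ) : ℝ) + 1 ∧ (1 : ℝ) ≤ ((n - 1 : ℕ) : ℝ) := by
    filter_upwards [eventually_ge_atTop 2] with n hn
    have h : n = (n - 1) + 1 := by omega
    constructor
    · exact_mod_cast h
    · have : 1 ≤ n - 1 := by omega
      exact_mod_cast this
  have h0 : Tendsto (fun n => d n / Real.sqrt ((n - 1 : ℕ) : ℝ)) atTop atTop := by
    apply tendsto_atTop_mono' _ _ (zs_div_sqrt hp0 hp1)
    filter_upwards [hds, hNn] with n h ⟨hn, hn1⟩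
    have : 0 ≤ zs p n := Real.sqrt_nonneg _
    have h3 : 0 < Real.sqrt ((n - 1 : ℕ) : ℝ) := by positivity
    apply div_le_div₀ (by linarith) (by linarith) h3
    apply Real.sqrt_le_sqrt
    linarith
  have main := zmd hp0 hp1 (fun n => n - 1) k (fun n => zthr n p) d (fun n => zthr_nonneg n hp0)
    (fun n => rfl) (zsub_top 1) (fun n => rfl) h0 h1 h2
  have hA : Tendsto (fun n => zs p n / d n) atTop (nhds 1) := by
    have h3 : Tendsto (fun n => d n / zs p n - 1) atTop (nhds 0) := by
      have := (zs_top hp0 hp1).inv_tendsto_atTop.const_mul 2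
      rw [mul_zero] at this
      apply squeeze_zero_norm' _ this
      filter_upwards [hds', (zs_top hp0 hp1).eventually_gt_atTop 0] with n h hz
      rw [Real.norm_eq_abs, div_sub_one hz.ne', abs_div, abs_of_pos hz, div_eq_mul_inv]
      simp only [Pi.inv_apply]
      gcongr
    have h4 := (h3.add_const 1).inv₀ (by norm_num)
    simpa using h4
  have hB : Tendsto (fun n : ℕ => Real.sqrt (((n - 1 : ℕ) : ℝ) / n)) atTop (nhds 1) := by
    have h3 := (tendsto_one_div_atTop_nhds_zero_nat (𝕜 := ℝ)).const_sub 1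
    rw [sub_zero] at h3
    have h4 := h3.sqrt
    rw [Real.sqrt_one] at h4
    refine h4.congr' ?_
    filter_upwards [hNn] with n ⟨hn, hn1⟩
    congr 1
    have : ((n - 1 : ℕ) : ℝ) = n - 1 := by linarith
    rw [this]
    have : (n : ℝ) ≠ 0 := by linarith
    field_simp
  have hC : Tendsto (fun n : ℕ => Real.log n / 4 - d n ^ 2 / (2 * ((n - 1 : ℕ) : ℝ) * p * (1 - p)))
      atTop (nhds 0) := by
    have hb := ((zL_pow 1).const_mul (1 / 2)).add ((zs_div hp0 hp1).const_mul (8 / (p * (1 - p))))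
    rw [mul_zero, mul_zero, add_zero] at hb
    apply squeeze_zero_norm' _ hb
    filter_upwards [hds, hNn, (zs_top hp0 hp1).eventually_ge_atTop 1] with n ⟨ha, hb⟩ ⟨hn, hn1⟩ hs
    set N : ℝ := ((n - 1 : ℕ) : ℝ) with hN
    have hn0 : (1 : ℝ) ≤ n := by linarith
    have hL := Real.log_nonneg hn0
    have hs2 : zs p n ^ 2 = (1 / 2) * n * p * (1 - p) * Real.log n := Real.sq_sqrt (by positivity)
    have e : Real.log n / 4 - d n ^ 2 / (2 * N * p * (1 - p)) =
        - (Real.log n / (4 * N) + (d n - zs p n) * (d n + zs p n) / (2 * N * p * (1 - p))) := by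
      have : d n ^ 2 = zs p n ^ 2 + (d n - zs p n) * (d n + zs p n) := by ring
      rw [this, hs2, hn]
      field_simp
      ring
    have hN2 : (n : ℝ) / 2 ≤ N := by linarith
    rw [e, norm_neg, Real.norm_eq_abs, abs_of_nonneg (by
      apply add_nonneg (by positivity)
      apply div_nonneg (mul_nonneg ha (by linarith)) (by positivity))]
    have b1 : Real.log n / (4 * N) ≤ Real.log n / (4 * (n / 2)) := by gcongr
    have b2 : (d n - zs p n) * (d n + zs p n) / (2 * N * p * (1 - p)) ≤
        (8 * zs p n) / (2 * (n / 2) * p * (1 - p)) := by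
      have b3 : (d n - zs p n) * (d n + zs p n) ≤ 8 * zs p n :=
        calc (d n - zs p n) * (d n + zs p n) ≤ 2 * (4 * zs p n) :=
              mul_le_mul hb (by linarith) (by linarith) (by norm_num)
          _ = _ := by ring
      apply div_le_div₀ (by linarith) b3 (by positivity)
      gcongr
    calc _ ≤ _ := add_le_add b1 b2
      _ = _ := by field_simp; ring
  have hF := ((main.mul hA).mul hB).mul ((Real.continuous_exp.tendsto 0).comp hC)
  rw [Real.exp_zero] at hF
  simp only [mul_one] at hF
  refine hF.congr' ?_
  filter_upwards [hNn, eventually_ge_atTop 2, hds, (zs_top hp0 hp1).eventually_ge_atTop 1]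
    with n ⟨hn, hn1⟩ hn2 hdn hsn
  obtain ⟨r1, -, r3⟩ := zrep n hn2
  have hL : 0 < Real.log n := Real.log_pos (by linarith)
  simp only [Function.comp]
  have hdp : 0 < d n := by linarith [hdn.1]
  rw [r1, Real.exp_sub]
  have hPe : zP n p = zSum p (n - 1) (zind (zthr n p)) := rfl
  rw [← hPe]
  have hX := Real.exp_pos (d n ^ 2 / (2 * ((n - 1 : ℕ) : ℝ) * p * (1 - p)))
  set X := Real.exp (d n ^ 2 / (2 * ((n - 1 : ℕ) : ℝ) * p * (1 - p)))
  set r := Real.exp (Real.log n / 4) with hr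
  have hrp : 0 < r := Real.exp_pos _
  have hsq : Real.sqrt (2 * Real.pi) / Real.sqrt (((n - 1 : ℕ) : ℝ) * p * (1 - p)) * zs p n *
      Real.sqrt (((n - 1 : ℕ) : ℝ) / n) = Real.sqrt (Real.pi * Real.log n) := by
    unfold zs
    rw [← Real.sqrt_div (by positivity), ← Real.sqrt_mul (by positivity), ← Real.sqrt_mul (by positivity)]
    congr 1
    have : (n : ℝ) ≠ 0 := by linarith
    field_simp
  have hpl : 0 < Real.sqrt (Real.pi * Real.log n) := by positivity
  calc _ = (Real.sqrt (2 * Real.pi) / Real.sqrt (((n - 1 : ℕ) : ℝ) * p * (1 - p)) * zs p n *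
      Real.sqrt (((n - 1 : ℕ) : ℝ) / n)) * zP n p * r := by
        field_simp
    _ = _ := by
        rw [hsq]
        rw [div_div_eq_mul_div, eq_div_iff (by positivity)]
        linear_combination (-(Real.sqrt (Real.pi * Real.log n) * zP n p)) * r3

lemma zz_bound {p : ℝ} (hp0 : 0 < p) (hp1 : p < 1) : ∃ C : ℝ, 0 ≤ C ∧
    ∀ᶠ n : ℕ in atTop, zb p (n - 2) ⌊zthr n p⌋₊ * Real.sqrt n ≤ C := by
  have hq : 0 < 1 - p := by linarith
  have hpi := Real.pi_pos
  set d : ℕ → ℝ := fun n => ⌊zthr n p⌋₊ - ((n - 2 : ℕ) : ℝ) * p with hd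
  have hds' : ∀ᶠ n in atTop, |d n - zs p n| ≤ 2 := by
    filter_upwards [eventually_ge_atTop 2] with n hn
    have h1 := Nat.floor_le (zthr_nonneg n hp0)
    have h2 := Nat.lt_floor_add_one (zthr n p)
    simp only [hd]
    rw [Nat.cast_sub hn]
    rw [zthr_eq] at *
    push_cast
    rw [abs_le]
    constructor <;> nlinarith
  obtain ⟨h1, h2⟩ := zd_lims hp0 hp1 2 d hds'
  have main := zlocal hp0 hp1 (fun n => n - 2) (fun n => ⌊zthr n p⌋₊) d (zsub_top 2) (fun n => rfl) h1 h2
  refine ⟨2 / Real.sqrt (Real.pi * p * (1 - p)), by positivity, ?_⟩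
  filter_upwards [main.eventually_le_const (u := 2) (by norm_num), eventually_ge_atTop 4] with n hn hn4
  have hs : 0 < Real.sqrt (Real.pi * p * (1 - p)) := by positivity
  rw [le_div_iff₀ hs]
  refine le_trans ?_ hn
  have hz := zb_nonneg hp0 hp1 (n - 2) ⌊zthr n p⌋₊
  have he : 1 ≤ Real.exp (d n ^ 2 / (2 * ((n - 2 : ℕ) : ℝ) * p * (1 - p))) :=
    Real.one_le_exp (by positivity)
  refine le_trans ?_ (le_mul_of_one_le_right (by positivity) he)
  rw [mul_assoc]
  apply mul_le_mul_of_nonneg_left _ hz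
  rw [← Real.sqrt_mul (by positivity)]
  apply Real.sqrt_le_sqrt
  have : (n : ℝ) ≤ 2 * ((n - 2 : ℕ) : ℝ) := by
    have : n ≤ 2 * (n - 2) := by omega
    exact_mod_cast this
  calc (n : ℝ) * (Real.pi * p * (1 - p)) ≤ (2 * ((n - 2 : ℕ) : ℝ)) * (Real.pi * p * (1 - p)) := by gcongr
    _ = _ := by ring

lemma zr_top : Tendsto (fun n : ℕ => Real.exp (Real.log (n : ℝ) / 4)) atTop atTop :=
  Real.tendsto_exp_atTop.comp (zL_top.atTop_div_const (by norm_num))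

lemma zlr : Tendsto (fun n : ℕ => Real.sqrt (Real.pi * Real.log n) / Real.exp (Real.log (n : ℝ) / 4))
    atTop (nhds 0) := by
  have h := (Real.tendsto_pow_mul_exp_neg_atTop_nhds_zero 1).comp (zL_top.atTop_div_const (r := 2) (by norm_num))
  have h2 := (h.const_mul (2 * Real.pi)).sqrt
  rw [mul_zero, Real.sqrt_zero] at h2
  refine h2.congr ?_
  intro n
  simp only [Function.comp]
  have e : Real.exp (Real.log (n : ℝ) / 4) = Real.sqrt (Real.exp (Real.log (n : ℝ) / 4) ^ 2) :=
    (Real.sqrt_sq (Real.exp_pos _).le).symm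
  rw [e, ← Real.sqrt_div' _ (by positivity)]
  congr 1
  rw [← Real.exp_nat_mul, Real.exp_neg]
  have : ((2 : ℕ) : ℝ) * (Real.log n / 4) = Real.log n / 2 := by push_cast; ring
  rw [this]
  field_simp

/-- `E[ζ] ~ √(n^{3/2}/(π ln n))`, and for every fixed `c > 0`, a.a.s.
`ζ > c·√(n/(π ln n))`. -/
theorem zeta_expectation_and_aas (p : ℝ) (hp0 : 0 < p) (hp1 : p < 1) :
    Tendsto (fun n : ℕ =>
        grEx n p (fun G => (zeta n p G : ℝ)) /
          Real.sqrt ((n : ℝ) ^ ((3 : ℝ) / 2) / (Real.pi * Real.log n)))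
      atTop (nhds 1) ∧
    ∀ c : ℝ, 0 < c →
      Tendsto (fun n : ℕ =>
          grPr n p {G | c * Real.sqrt ((n : ℝ) / (Real.pi * Real.log n)) < (zeta n p G : ℝ)})
        atTop (nhds 1) := by
  have hmean := zmean hp0 hp1
  refine ⟨by simpa only [grEx_zeta] using hmean, ?_⟩
  intro c hc
  obtain ⟨C, hC0, hC⟩ := zz_bound hp0 hp1
  have hpi := Real.pi_pos
  set M : ℕ → ℝ := fun n => Real.sqrt ((n : ℝ) ^ ((3 : ℝ) / 2) / (Real.pi * Real.log n)) with hM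
  set x : ℕ → ℝ := fun n => c * Real.sqrt ((n : ℝ) / (Real.pi * Real.log n)) with hx
  have hMpos : ∀ᶠ n in atTop, 0 < M n := by
    filter_upwards [eventually_ge_atTop 2] with n hn
    have hL : 0 < Real.log n := Real.log_pos (by exact_mod_cast hn)
    simp only [hM]
    rw [(zrep n hn).1]
    positivity
  have hxM : Tendsto (fun n => x n / M n) atTop (nhds 0) := by
    have h := zr_top.inv_tendsto_atTop.const_mul c
    rw [mul_zero] at h
    refine h.congr' ?_
    filter_upwards [eventually_ge_atTop 2] with n hn
    have hL : 0 < Real.log n := Real.log_pos (by exact_mod_cast hn)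
    simp only [hM, hx, Pi.inv_apply]
    rw [(zrep n hn).1, (zrep n hn).2.1]
    have : 0 < Real.sqrt (Real.pi * Real.log n) := by positivity
    have := Real.exp_pos (Real.log n / 4)
    field_simp
  have hsM : Tendsto (fun n : ℕ => Real.sqrt n / M n) atTop (nhds 0) := by
    refine zlr.congr' ?_
    filter_upwards [eventually_ge_atTop 2] with n hn
    have hL : 0 < Real.log n := Real.log_pos (by exact_mod_cast hn)
    have e4 : Real.sqrt (n : ℝ) = Real.exp (Real.log n / 4) ^ 2 := by
      rw [Real.sqrt_eq_iff_mul_self_eq (by positivity) (by positivity)]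
      exact (zrep n hn).2.2.trans (by ring)
    simp only [hM]
    rw [(zrep n hn).1, e4]
    have : 0 < Real.sqrt (Real.pi * Real.log n) := by positivity
    have := Real.exp_pos (Real.log n / 4)
    field_simp
  have hM1 : Tendsto (fun n : ℕ => 1 / M n) atTop (nhds 0) := by
    apply squeeze_zero' _ _ hsM
    · filter_upwards [hMpos] with n h
      positivity
    · filter_upwards [hMpos, eventually_ge_atTop 1] with n h hn
      have : 1 ≤ Real.sqrt n := Real.one_le_sqrt.2 (by exact_mod_cast hn)
      gcongr
  have hzM : Tendsto (fun n : ℕ => n * zb p (n - 2) ⌊zthr n p⌋₊ / M n) atTop (nhds 0) := by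
    have h := hsM.const_mul C
    rw [mul_zero] at h
    apply squeeze_zero' _ _ h
    · filter_upwards [hMpos] with n h
      have := zb_nonneg hp0 hp1 (n - 2) ⌊zthr n p⌋₊
      positivity
    · filter_upwards [hMpos, hC] with n h hCn
      rw [← mul_div_assoc]
      apply div_le_div_of_nonneg_right _ h.le
      have e : (n : ℝ) = Real.sqrt n * Real.sqrt n := (Real.mul_self_sqrt (Nat.cast_nonneg n)).symm
      calc (n : ℝ) * zb p (n - 2) ⌊zthr n p⌋₊ = (zb p (n - 2) ⌊zthr n p⌋₊ * Real.sqrt n) * Real.sqrt n := by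
            nth_rewrite 1 [e]; ring
        _ ≤ _ := by gcongr
  have hfrac : Tendsto (fun n : ℕ => 1 - (n * zP n p + n ^ 2 * (zb p (n - 2) ⌊zthr n p⌋₊) ^ 2) /
      (n * zP n p - x n) ^ 2) atTop (nhds 1) := by
    have h1 := (hmean.mul hM1).add (hzM.pow 2)
    have h2 := (hmean.sub hxM).pow 2
    have h3 := (h1.div h2 (by norm_num)).const_sub 1
    have e : (1 : ℝ) - (1 * 0 + 0 ^ 2) / (1 - 0) ^ 2 = 1 := by norm_num
    rw [e] at h3
    refine h3.congr' ?_
    filter_upwards [hMpos] with n h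
    simp only [Pi.div_apply]
    congr 1
    change ((n : ℝ) * zP n p / M n * (1 / M n) + (n * zb p (n - 2) ⌊zthr n p⌋₊ / M n) ^ 2) /
      (n * zP n p / M n - x n / M n) ^ 2 = _
    rw [← sub_div, div_pow, div_pow, ← mul_div_mul_comm, mul_one, ← sq, ← add_div,
      div_div_div_cancel_right₀ (by positivity), mul_pow]
  apply tendsto_of_tendsto_of_tendsto_of_le_of_le' hfrac tendsto_const_nhds
  · have hlt := hxM.eventually_lt hmean one_pos
    filter_upwards [hlt, hMpos, eventually_ge_atTop 2] with n h1 h2 h3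
    have h4 : x n < n * zP n p := (div_lt_div_iff_of_pos_right h2).1 h1
    exact zcheb n h3 hp0 hp1 (x n) h4
  · exact Eventually.of_forall fun n => grPr_le_one n hp0 hp1 _
end
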